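/- Let ℙ be a probability measure on Ω₊ under which (ω(x))_{x≥0} is stationary and ergodic. Then for every x ≥ 0, the expected total drift ever consumed at site x under the annealed measure P_0 equals E_0[D_∞^x] = min{1, 𝔼[δ^0]}, where δ^0(ω) := Σ_{i≥1} (2ω(0,i) − 1). -/

import Mathlib

open MeasureTheory Filter Set Topology ProbabilityTheory
open scoped ENNReal ENat

noncomputable section

/-- A cookie environment: `ω z i` is the strength of the `(i+1)`-st cookie at site `z`
(cookies at each site are indexed by `i = 0, 1, 2, …`). -/
abbrev CEnv : Type := ℤ → ℕ → ℝ

/-- `ω` belongs to `Ω₊`, i.e. all cookie strengths lie in `[1/2, 1]`. -/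
def IsCookieEnv (ω : CEnv) : Prop := ∀ z i, ω z i ∈ Set.Icc (1/2 : ℝ) 1

/-- The number of visits of the path `x` to the site `x n` at times `m < n`. -/
def prevVisits (x : ℕ → ℤ) (n : ℕ) : ℕ :=
  ((Finset.range n).filter fun m => x m = x n).card

/-- The probability of the step from `x n` to `x (n+1)` for the multi-excited random
walk: jump to the right with the strength of the bottom remaining cookie at the current
site, to the left with the complementary probability. -/
def stepProb (ω : CEnv) (x : ℕ → ℤ) (n : ℕ) : ℝ :=
  if x (n+1) = x n + 1 then ω (x n) (prevVisits x n)
  else if x (n+1) = x n - 1 then 1 - ω (x n) (prevVisits x n)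
  else 0

/-- The probability that the walk started at `x0` follows the path `x` up to time `n`. -/
def cylProb (ω : CEnv) (x0 : ℤ) (x : ℕ → ℤ) (n : ℕ) : ℝ :=
  (if x 0 = x0 then 1 else 0) * ∏ m ∈ Finset.range n, stepProb ω x m

/-- `P` is the law `P_{x0,ω}` of the multi-excited random walk in the cookie
environment `ω` started at `x0`, characterized by its cylinder probabilities. -/
def IsERWLaw (ω : CEnv) (x0 : ℤ) (P : Measure (ℕ → ℤ)) : Prop :=
  IsProbabilityMeasure P ∧
    ∀ (x : ℕ → ℤ) (n : ℕ),
      P {Y | ∀ m ≤ n, Y m = x m} = ENNReal.ofReal (cylProb ω x0 x n)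

/-- First passage time `T_k`, with value `∞` if `k` is never visited. -/
def T (k : ℤ) (Y : ℕ → ℤ) : ℕ∞ :=
  sInf {t : ℕ∞ | ∃ n : ℕ, (n : ℕ∞) = t ∧ Y n = k}

/-- First passage time of an extended-real level, with the convention
`T_{−∞} = T_{+∞} = ∞`. -/
def Te (k : EReal) (Y : ℕ → ℤ) : ℕ∞ :=
  sInf {t : ℕ∞ | ∃ n : ℕ, (n : ℕ∞) = t ∧ ((Y n : ℝ) : EReal) = k}

/-- `R_k`, the event that the site `k` is visited infinitely often. -/
def Rset (k : ℤ) : Set (ℕ → ℤ) := {Y | ∀ N : ℕ, ∃ n ≥ N, Y n = k}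

/-- The number of visits of `Y` to the site `s` at times `< t`. -/
def visitsBefore (Y : ℕ → ℤ) (s : ℤ) (t : ℕ∞) : ℕ∞ :=
  {m : ℕ | (m : ℕ∞) < t ∧ Y m = s}.encard

/-- `D_t^s`: the total drift stored in the cookies consumed at the site `s`
before time `t` (a time in `ℕ∞`; `t = ∞` gives `D_∞^s`). -/
def driftAt (ω : CEnv) (Y : ℕ → ℤ) (s : ℤ) (t : ℕ∞) : ℝ≥0∞ :=
  ∑' i : ℕ, Set.indicator {i : ℕ | (i : ℕ∞) < visitsBefore Y s t}
    (fun i => ENNReal.ofReal (2 * ω s i - 1)) i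

/-- `D_t`: the total drift consumed before time `t` (at all sites). -/
def Dtot (ω : CEnv) (Y : ℕ → ℤ) (t : ℕ∞) : ℝ≥0∞ := ∑' s : ℤ, driftAt ω Y s t

/-- `D_t^+`: the total drift consumed at nonnegative sites before time `t`. -/
def DtotPos (ω : CEnv) (Y : ℕ → ℤ) (t : ℕ∞) : ℝ≥0∞ := ∑' s : ℕ, driftAt ω Y (s : ℤ) t

/-- `δ^s`: the total drift stored in the cookies at the site `s`. -/
def cookieDrift (ω : CEnv) (s : ℤ) : ℝ≥0∞ := ∑' i : ℕ, ENNReal.ofReal (2 * ω s i - 1)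

/-- The successive times `τ_{k,1}, τ_{k,2}, …` (indexed here from `0`) at which the
walk is at a site `≥ k`. -/
def tauT (k : ℤ) (Y : ℕ → ℤ) : ℕ → ℕ∞
  | 0 => sInf {t : ℕ∞ | ∃ n : ℕ, (n : ℕ∞) = t ∧ k ≤ Y n}
  | m + 1 => sInf {t : ℕ∞ | ∃ n : ℕ, (n : ℕ∞) = t ∧ tauT k Y m < (n : ℕ∞) ∧ k ≤ Y n}

/-- The observed sequence `(X_{τ_{k,m}})_{m ≥ 1}` (indexed here from `0`). -/
def obsSeq (k : ℤ) (Y : ℕ → ℤ) (m : ℕ) : ℤ := Y (tauT k Y m).toNat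

/-- The one-sided shift on sequences. -/
def shiftSeq {α : Type*} (u : ℕ → α) : ℕ → α := fun n => u (n + 1)

/-- The restriction `(ω(x))_{x ≥ 0}` of an environment to the nonnegative sites. -/
def restrictNN (ω : CEnv) : ℕ → ℕ → ℝ := fun x => ω (x : ℤ)

/-- `(ω(x))_{x ≥ 0}` is stationary under `Pr`: its law is invariant under the shift. -/
def IsStationaryEnv (Pr : Measure CEnv) : Prop :=
  MeasurePreserving shiftSeq (Pr.map restrictNN) (Pr.map restrictNN)

/-- `(ω(x))_{x ≥ 0}` is stationary and ergodic under `Pr`. -/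
def IsStatErgEnv (Pr : Measure CEnv) : Prop :=
  Ergodic shiftSeq (Pr.map restrictNN)

/-- The process `ξ_k = ((ω(x+k))_{x≥0}, (X_{τ_{k,m}} − k)_{m≥0})` consisting of the
environment to the right of `k` and the trajectory at sites `≥ k`, recentered at `k`. -/
def xiProc (p : CEnv × (ℕ → ℤ)) (k : ℕ) : (ℕ → ℕ → ℝ) × (ℕ → ℤ) :=
  (fun x : ℕ => p.1 ((x : ℤ) + (k : ℤ)), fun m => obsSeq (k : ℤ) p.2 m - (k : ℤ))

/-- The number of right instructions among the first `i` entries of a stack. -/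
def rightCount (s : ℕ → Bool) (i : ℕ) : ℕ :=
  ∑ j ∈ Finset.range i, if s j then 1 else 0

/-- Indicator that the `i`-th entry of the stack is used when the stack is read until
`n + 1` right instructions have been found. -/
def usedInd (s : ℕ → Bool) (n : ℝ≥0∞) (i : ℕ) : ℝ≥0∞ :=
  if (rightCount s i : ℝ≥0∞) < n + 1 then 1 else 0

/-- The number of left instructions preceding the `(n + 1)`-st right instruction. -/
def leftsBefore (s : ℕ → Bool) (n : ℝ≥0∞) : ℝ≥0∞ :=
  ∑' i, usedInd s n i * if s i then 0 else 1

/-- The drift of the cookies used up to the `(n + 1)`-st right instruction. -/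
def driftBefore (p : ℕ → ℝ) (s : ℕ → Bool) (n : ℝ≥0∞) : ℝ≥0∞ :=
  ∑' i, usedInd s n i * ENNReal.ofReal (2 * p i - 1)

/-- The number of right instructions used up to the `(n + 1)`-st right instruction. -/
def rightsBefore (s : ℕ → Bool) (n : ℝ≥0∞) : ℝ≥0∞ :=
  ∑' i, usedInd s n i * if s i then 1 else 0

/-- The stack of instructions produced by cookie strengths `p` and uniform variables `u`. -/
def arrows (p u : ℕ → ℝ) : ℕ → Bool := fun i => decide (u i < p i)

lemma rightCount_succ (s : ℕ → Bool) (i : ℕ) :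
    rightCount s (i + 1) = rightCount s i + if s i then 1 else 0 := by
  rw [rightCount, Finset.sum_range_succ, rightCount]

lemma rightCount_mono (s : ℕ → Bool) : Monotone (rightCount s) :=
  monotone_nat_of_le_succ fun i => by rw [rightCount_succ]; omega

lemma natCast_lt_add_one_iff (a n : ℕ) : (a : ℝ≥0∞) < (n : ℝ≥0∞) + 1 ↔ a ≤ n := by
  rw [← Nat.cast_one, ← Nat.cast_add, Nat.cast_lt, Nat.lt_succ_iff]

lemma sum_rights (s : ℕ → Bool) (n N : ℕ) :
    ∑ i ∈ Finset.range N, usedInd s n i * (if s i then 1 else 0) =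
      ((min (rightCount s N) (n + 1) : ℕ) : ℝ≥0∞) := by
  induction N with
  | zero => simp [rightCount]
  | succ N ih =>
    rw [Finset.sum_range_succ, ih, rightCount_succ, usedInd]
    simp only [natCast_lt_add_one_iff]
    by_cases h : s N <;> by_cases h2 : rightCount s N ≤ n <;> simp only [h, h2, if_true, if_false]
    · rw [min_eq_left (by omega), min_eq_left (by omega)]; simp
    · rw [min_eq_right (by omega), min_eq_right (by omega)]; simp
    · simp
    · simp

lemma rightsBefore_natCast (s : ℕ → Bool) (n : ℕ) :
    rightsBefore s n = ⨆ N, ((min (rightCount s N) (n + 1) : ℕ) : ℝ≥0∞) := by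
  rw [rightsBefore, ENNReal.tsum_eq_iSup_nat]
  simp_rw [sum_rights]

lemma rightsBefore_natCast_le (s : ℕ → Bool) (n : ℕ) : rightsBefore s n ≤ n + 1 := by
  rw [rightsBefore_natCast]
  refine iSup_le fun N => ?_
  exact_mod_cast min_le_right _ _

/-- A natural number or `∞`. -/
def IsNatOrTop (n : ℝ≥0∞) : Prop := n = ⊤ ∨ ∃ k : ℕ, n = k

lemma rightsBefore_eq {s : ℕ → Bool} (hs : ∀ m, ∃ i, m ≤ rightCount s i) {n : ℝ≥0∞}
    (hn : IsNatOrTop n) : rightsBefore s n = n + 1 := by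
  rcases hn with rfl | ⟨n, rfl⟩
  · rw [top_add, eq_top_iff]
    refine ENNReal.le_of_forall_nnreal_lt fun r _ => ?_
    obtain ⟨k, hk⟩ := exists_nat_ge r
    obtain ⟨i, hi⟩ := hs k
    calc (r : ℝ≥0∞) ≤ (k : ℝ≥0∞) := by exact_mod_cast hk
      _ ≤ (rightCount s i : ℝ≥0∞) := by exact_mod_cast hi
      _ = ∑ j ∈ Finset.range i, usedInd s ⊤ j * (if s j then 1 else 0) := by
        simp [rightCount, usedInd]
      _ ≤ _ := ENNReal.sum_le_tsum _
  · refine le_antisymm (rightsBefore_natCast_le s n) ?_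
    obtain ⟨i, hi⟩ := hs (n + 1)
    rw [rightsBefore_natCast]
    refine le_trans ?_ (le_iSup _ i)
    rw [min_eq_right hi]; simp

lemma tsum_ite_isNatOrTop (P : ℕ → Prop) [DecidablePred P] :
    IsNatOrTop (∑' i, if P i then (1 : ℝ≥0∞) else 0) := by
  have h : (∑' i, if P i then (1 : ℝ≥0∞) else 0) = ∑' _ : {i | P i}, (1 : ℝ≥0∞) := by
    rw [tsum_subtype {i | P i} (fun _ => (1 : ℝ≥0∞))]
    simp [Set.indicator_apply]
  rw [h, ENNReal.tsum_set_one]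
  by_cases hf : {i | P i}.Finite
  · refine Or.inr ⟨{i | P i}.ncard, ?_⟩
    rw [← hf.cast_ncard_eq]; simp
  · left; rw [Set.Infinite.encard_eq hf]; simp

lemma leftsBefore_isNatOrTop (s : ℕ → Bool) (n : ℝ≥0∞) : IsNatOrTop (leftsBefore s n) := by
  classical
  have := tsum_ite_isNatOrTop fun i => (rightCount s i : ℝ≥0∞) < n + 1 ∧ s i = false
  convert this using 1
  refine tsum_congr fun i => ?_
  unfold usedInd
  by_cases h : s i <;> simp [h]

lemma usedInd_mono (s : ℕ → Bool) (i : ℕ) : Monotone fun n => usedInd s n i := by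
  intro m n h
  simp only [usedInd]
  split_ifs with h1 h2
  · exact le_rfl
  · exact absurd (h1.trans_le (by gcongr)) h2
  · simp
  · exact le_rfl

lemma leftsBefore_mono (s : ℕ → Bool) : Monotone (leftsBefore s) := fun _ _ h =>
  ENNReal.tsum_le_tsum fun i => mul_le_mul_left (usedInd_mono s i h) _

lemma driftBefore_mono (p : ℕ → ℝ) (s : ℕ → Bool) : Monotone (driftBefore p s) := fun _ _ h =>
  ENNReal.tsum_le_tsum fun i => mul_le_mul_left (usedInd_mono s i h) _

lemma usedInd_iSup (s : ℕ → Bool) (f : ℕ → ℝ≥0∞) (i : ℕ) :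
    usedInd s (⨆ k, f k) i = ⨆ k, usedInd s (f k) i := by
  refine le_antisymm ?_ (iSup_le fun k => usedInd_mono s i (le_iSup f k))
  by_cases h : (rightCount s i : ℝ≥0∞) < (⨆ k, f k) + 1
  · rw [ENNReal.iSup_add, lt_iSup_iff] at h
    obtain ⟨k, hk⟩ := h
    refine le_trans ?_ (le_iSup _ k)
    simp only [usedInd, if_pos hk]
    split_ifs <;> simp
  · simp [usedInd, h]

lemma tsum_usedInd_iSup (s : ℕ → Bool) {f : ℕ → ℝ≥0∞} (hf : Monotone f) (g : ℕ → ℝ≥0∞) :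
    ∑' i, usedInd s (⨆ k, f k) i * g i = ⨆ k, ∑' i, usedInd s (f k) i * g i := by
  simp_rw [usedInd_iSup, ENNReal.iSup_mul, ← lintegral_count]
  exact lintegral_iSup (fun k => measurable_of_countable _)
    fun a b h i => mul_le_mul_left (usedInd_mono s i (hf h)) _

lemma leftsBefore_iSup (s : ℕ → Bool) {f : ℕ → ℝ≥0∞} (hf : Monotone f) :
    leftsBefore s (⨆ k, f k) = ⨆ k, leftsBefore s (f k) := tsum_usedInd_iSup s hf _

lemma driftBefore_iSup (p : ℕ → ℝ) (s : ℕ → Bool) {f : ℕ → ℝ≥0∞} (hf : Monotone f) :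
    driftBefore p s (⨆ k, f k) = ⨆ k, driftBefore p s (f k) := tsum_usedInd_iSup s hf _

section Measurability

variable {α : Type*} [MeasurableSpace α]

@[fun_prop]
lemma measurable_arrows {f g : α → ℕ → ℝ} (hf : Measurable f) (hg : Measurable g) :
    Measurable fun a => arrows (f a) (g a) := by
  refine measurable_pi_iff.2 fun i => ?_
  have : Measurable fun a => if g a i < f a i then true else false :=
    Measurable.ite (measurableSet_lt (by fun_prop) (by fun_prop)) measurable_const measurable_const
  simpa [arrows] using this

lemma measurable_bool_ite {β : Type*} [MeasurableSpace β] {f : α → ℕ → Bool} (hf : Measurable f)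
    (i : ℕ) (x y : β) : Measurable fun a => if f a i then x else y :=
  Measurable.ite (((measurable_pi_apply i).comp hf) (measurableSet_singleton true))
    measurable_const measurable_const

@[fun_prop]
lemma measurable_rightCount {f : α → ℕ → Bool} (hf : Measurable f) (i : ℕ) :
    Measurable fun a => rightCount (f a) i :=
  Finset.measurable_sum _ fun j _ => measurable_bool_ite hf j 1 0

@[fun_prop]
lemma measurable_usedInd {f : α → ℕ → Bool} {g : α → ℝ≥0∞} (hf : Measurable f)
    (hg : Measurable g) (i : ℕ) : Measurable fun a => usedInd (f a) (g a) i := by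
  refine Measurable.ite (measurableSet_lt ?_ (by fun_prop)) measurable_const measurable_const
  exact (measurable_of_countable fun n : ℕ => (n : ℝ≥0∞)).comp (measurable_rightCount hf i)

@[fun_prop]
lemma measurable_leftsBefore {f : α → ℕ → Bool} {g : α → ℝ≥0∞} (hf : Measurable f)
    (hg : Measurable g) : Measurable fun a => leftsBefore (f a) (g a) :=
  Measurable.tsum fun i => (measurable_usedInd hf hg i).mul (measurable_bool_ite hf i 0 1)

@[fun_prop]
lemma measurable_driftBefore {p : α → ℕ → ℝ} {f : α → ℕ → Bool} {g : α → ℝ≥0∞}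
    (hp : Measurable p) (hf : Measurable f) (hg : Measurable g) :
    Measurable fun a => driftBefore (p a) (f a) (g a) :=
  Measurable.tsum fun i => (measurable_usedInd hf hg i).mul (by fun_prop)

end Measurability

/-- The uniform distribution on `[0, 1]`. -/
def unif : Measure ℝ := volume.restrict (Icc 0 1)

instance : IsProbabilityMeasure unif := ⟨by simp [unif]⟩

lemma unif_lt {p : ℝ} (hp : p ∈ Icc (0 : ℝ) 1) : unif {a | a < p} = ENNReal.ofReal p := by
  have : {a | a < p} ∩ Icc (0 : ℝ) 1 = Ico 0 p := by
    ext a; simp only [mem_inter_iff, mem_ofPred_eq, mem_Icc, mem_Ico]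
    constructor
    · rintro ⟨h1, h2, h3⟩; exact ⟨h2, h1⟩
    · rintro ⟨h1, h2⟩; exact ⟨h2, h1, by linarith [hp.2]⟩
  rw [unif, Measure.restrict_apply (measurableSet_lt (by fun_prop) (by fun_prop)), this]
  simp

lemma unif_not_lt {p : ℝ} (hp : p ∈ Icc (0 : ℝ) 1) :
    unif {a | ¬ a < p} = ENNReal.ofReal (1 - p) := by
  have := prob_compl_eq_one_sub (μ := unif) (s := {a : ℝ | a < p})
    (measurableSet_lt (by fun_prop) (by fun_prop))
  rw [unif_lt hp] at this
  rw [ENNReal.ofReal_sub _ hp.1, ENNReal.ofReal_one, ← this]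
  rfl

/-- The law of the uniform variables of a single stack. -/
def stackMeas : Measure (ℕ → ℝ) := Measure.infinitePi fun _ => unif

instance : IsProbabilityMeasure stackMeas := by unfold stackMeas; infer_instance

lemma lintegral_mul_coord {H : (ℕ → ℝ) → ℝ≥0∞} (hH : Measurable H) {i : ℕ}
    (hdep : ∀ u v, (∀ j < i, u j = v j) → H u = H v) {g : ℝ → ℝ≥0∞} (hg : Measurable g) :
    ∫⁻ u, H u * g (u i) ∂stackMeas = (∫⁻ u, H u ∂stackMeas) * ∫⁻ a, g a ∂unif := by
  have hind : iIndepFun (fun j (u : ℕ → ℝ) => u j) stackMeas :=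
    iIndepFun_infinitePi (X := fun _ a => a) (by fun_prop)
  have h2 := hind.indepFun_finset (Finset.range i) {i} (by simp) (by fun_prop)
  let ext : (Finset.range i → ℝ) → (ℕ → ℝ) := fun v j =>
    if h : j ∈ Finset.range i then v ⟨j, h⟩ else 0
  have hext : Measurable ext := by
    refine measurable_pi_iff.2 fun j => ?_
    by_cases h : j ∈ Finset.range i
    · simp only [ext, h, dite_true]; fun_prop
    · simp only [ext, h, dite_false]; fun_prop
  have hi : i ∈ ({i} : Finset ℕ) := by simp
  have h3 : IndepFun (fun u : ℕ → ℝ => H (ext fun j : Finset.range i => u j)) (fun u => g (u i))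
      stackMeas :=
    h2.comp (φ := fun v : Finset.range i → ℝ => H (ext v))
      (ψ := fun v : ({i} : Finset ℕ) → ℝ => g (v ⟨i, hi⟩)) (hH.comp hext)
      (hg.comp (measurable_pi_apply (⟨i, hi⟩ : ({i} : Finset ℕ))))
  have h4 := lintegral_mul_eq_lintegral_mul_lintegral_of_indepFun
    (μ := stackMeas) (f := fun u => H (ext fun j : Finset.range i => u j)) (g := fun u => g (u i))
    (hH.comp (hext.comp (by fun_prop :
      Measurable fun (u : ℕ → ℝ) (j : Finset.range i) => u j)))
    (hg.comp (measurable_pi_apply i)) h3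
  have h5 : ∀ u : ℕ → ℝ, H (ext fun j : Finset.range i => u j) = H u := fun u =>
    hdep _ _ fun j hj => by simp [ext, hj]
  simp only [Pi.mul_apply, h5] at h4
  rw [h4]
  congr 1
  have := lintegral_map (μ := stackMeas) hg (measurable_pi_apply i)
  rw [← this]
  congr 1
  exact Measure.infinitePi_map_eval (fun _ => unif) i

lemma lintegral_right {H : (ℕ → ℝ) → ℝ≥0∞} (hH : Measurable H) {i : ℕ}
    (hdep : ∀ u v, (∀ j < i, u j = v j) → H u = H v) {p : ℕ → ℝ} (hp : p i ∈ Icc (0 : ℝ) 1) :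
    ∫⁻ u, H u * (if arrows p u i then 1 else 0) ∂stackMeas =
      (∫⁻ u, H u ∂stackMeas) * ENNReal.ofReal (p i) := by
  have hm : MeasurableSet {a : ℝ | a < p i} := measurableSet_lt (by fun_prop) (by fun_prop)
  have := lintegral_mul_coord hH hdep (g := {a | a < p i}.indicator fun _ => 1)
    (measurable_const.indicator hm)
  rw [lintegral_indicator_const hm, unif_lt hp, one_mul] at this
  simpa [Set.indicator_apply, arrows] using this

lemma lintegral_left {H : (ℕ → ℝ) → ℝ≥0∞} (hH : Measurable H) {i : ℕ}
    (hdep : ∀ u v, (∀ j < i, u j = v j) → H u = H v) {p : ℕ → ℝ} (hp : p i ∈ Icc (0 : ℝ) 1) :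
    ∫⁻ u, H u * (if arrows p u i then 0 else 1) ∂stackMeas =
      (∫⁻ u, H u ∂stackMeas) * ENNReal.ofReal (1 - p i) := by
  have hm : MeasurableSet {a : ℝ | ¬ a < p i} :=
    (measurableSet_lt (measurable_id (α := ℝ)) (measurable_const (a := p i))).compl
  have := lintegral_mul_coord hH hdep (g := {a | ¬ a < p i}.indicator fun _ => 1)
    (measurable_const.indicator hm)
  rw [lintegral_indicator_const hm, unif_not_lt hp, one_mul] at this
  simp only [Set.indicator_apply, mem_ofPred_eq, ite_not] at this
  simpa [arrows] using this

lemma arrows_congr (p : ℕ → ℝ) {u v : ℕ → ℝ} {i : ℕ} (h : ∀ j < i, u j = v j) :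
    ∀ j < i, arrows p u j = arrows p v j := fun j hj => by simp [arrows, h j hj]

lemma rightCount_congr {s t : ℕ → Bool} {i : ℕ} (h : ∀ j < i, s j = t j) :
    rightCount s i = rightCount t i :=
  Finset.sum_congr rfl fun j hj => by rw [h j (Finset.mem_range.1 hj)]

lemma usedInd_arrows_congr (p : ℕ → ℝ) (n : ℝ≥0∞) {u v : ℕ → ℝ} {i : ℕ}
    (h : ∀ j < i, u j = v j) : usedInd (arrows p u) n i = usedInd (arrows p v) n i := by
  rw [usedInd, usedInd, rightCount_congr (arrows_congr p h)]

lemma lintegral_rightsBefore {p : ℕ → ℝ} (hp : ∀ i, p i ∈ Icc (1 / 2 : ℝ) 1) (n : ℝ≥0∞) :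
    ∫⁻ u, rightsBefore (arrows p u) n ∂stackMeas =
      ∑' i, (∫⁻ u, usedInd (arrows p u) n i ∂stackMeas) * ENNReal.ofReal (p i) := by
  unfold rightsBefore
  rw [lintegral_tsum]
  swap
  · exact fun i => ((measurable_usedInd (by fun_prop) measurable_const i).mul
      (measurable_bool_ite (by fun_prop) i _ _)).aemeasurable
  exact tsum_congr fun i => lintegral_right (by fun_prop)
    (fun u v h => usedInd_arrows_congr p n h) ⟨by linarith [(hp i).1], (hp i).2⟩

lemma lintegral_leftsBefore_add_driftBefore {p : ℕ → ℝ} (hp : ∀ i, p i ∈ Icc (1 / 2 : ℝ) 1)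
    (n : ℝ≥0∞) :
    ∫⁻ u, leftsBefore (arrows p u) n + driftBefore p (arrows p u) n ∂stackMeas =
      ∫⁻ u, rightsBefore (arrows p u) n ∂stackMeas := by
  rw [lintegral_rightsBefore hp]
  simp_rw [leftsBefore, driftBefore, ← ENNReal.tsum_add]
  rw [lintegral_tsum]
  swap
  · exact fun i => (((measurable_usedInd (by fun_prop) measurable_const i).mul
      (measurable_bool_ite (by fun_prop) i _ _)).add
      (by fun_prop)).aemeasurable
  refine tsum_congr fun i => ?_
  have h0 := (hp i).1
  have h1 := (hp i).2
  rw [lintegral_add_right _ (by fun_prop),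
    lintegral_left (by fun_prop)
      (fun u v h => usedInd_arrows_congr p n h) ⟨by linarith, h1⟩,
    lintegral_mul_const _ (by fun_prop), ← mul_add,
    ← ENNReal.ofReal_add (by linarith) (by linarith)]
  congr 2; ring

lemma ae_rightCount_unbounded {p : ℕ → ℝ} (hp : ∀ i, p i ∈ Icc (1 / 2 : ℝ) 1) :
    ∀ᵐ u ∂stackMeas, ∀ m, ∃ i, m ≤ rightCount (arrows p u) i := by
  rw [ae_all_iff]
  intro m
  have hsum : ∑' i, stackMeas {u | rightCount (arrows p u) i ≤ m} ≠ ⊤ := by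
    have hm : ∀ i, MeasurableSet {u | rightCount (arrows p u) i ≤ m} := fun i =>
      measurableSet_le (by fun_prop)
        measurable_const
    have h1 : ∑' i, stackMeas {u | rightCount (arrows p u) i ≤ m} * ENNReal.ofReal (1 / 2) ≤
        (m + 1 : ℝ≥0∞) := by
      calc _ ≤ ∑' i, (∫⁻ u, usedInd (arrows p u) m i ∂stackMeas) * ENNReal.ofReal (p i) := by
            refine ENNReal.tsum_le_tsum fun i => ?_
            gcongr
            · rw [← lintegral_indicator_one (hm i)]
              refine lintegral_mono fun u => ?_
              simp [usedInd, natCast_lt_add_one_iff, Set.indicator_apply]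
            · exact (hp i).1
        _ = _ := (lintegral_rightsBefore hp _).symm
        _ ≤ ∫⁻ _, (m + 1 : ℝ≥0∞) ∂stackMeas :=
            lintegral_mono fun u => rightsBefore_natCast_le _ _
        _ = _ := by simp
    rw [ENNReal.tsum_mul_right] at h1
    intro h
    rw [h, ENNReal.top_mul (by simp)] at h1
    exact absurd h1 (by simp)
  have hev : ∀ᵐ u ∂stackMeas, ∀ᶠ i in atTop, ¬ rightCount (arrows p u) i ≤ m := by
    exact ae_eventually_notMem hsum
  filter_upwards [hev] with u hu
  obtain ⟨i, hi⟩ := hu.exists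
  exact ⟨i, by omega⟩

lemma lintegral_leftsBefore_add_driftBefore_eq {p : ℕ → ℝ}
    (hp : ∀ i, p i ∈ Icc (1 / 2 : ℝ) 1) {n : ℝ≥0∞} (hn : IsNatOrTop n) :
    ∫⁻ u, leftsBefore (arrows p u) n + driftBefore p (arrows p u) n ∂stackMeas = n + 1 := by
  rw [lintegral_leftsBefore_add_driftBefore hp]
  calc _ = ∫⁻ _, (n + 1) ∂stackMeas := by
        refine lintegral_congr_ae ?_
        filter_upwards [ae_rightCount_unbounded hp] with u hu
        exact rightsBefore_eq hu hn
    _ = _ := by simp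

/-- The number of left instructions among the first `i` entries of the stack that are used
before the `(n + 1)`-st right instruction. -/
def leftCount (s : ℕ → Bool) (n i : ℕ) : ℕ :=
  ∑ j ∈ Finset.range i, if s j then 0 else if rightCount s j ≤ n then 1 else 0

/-- A quadratic supermartingale controlling the second moment of `leftsBefore`. -/
def quadPot (s : ℕ → Bool) (n i : ℕ) : ℕ :=
  (leftCount s n i + (n + 1 - rightCount s i)) ^ 2 + 2 * (n + 1 - rightCount s i)

/-- The size of the increments of `quadPot`. -/
def quadInc (s : ℕ → Bool) (n i : ℕ) : ℕ :=
  if rightCount s i ≤ n then 2 * (leftCount s n i + (n + 1 - rightCount s i)) + 1 else 0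

lemma leftCount_succ (s : ℕ → Bool) (n i : ℕ) : leftCount s n (i + 1) =
    leftCount s n i + if s i then 0 else if rightCount s i ≤ n then 1 else 0 := by
  rw [leftCount, Finset.sum_range_succ, leftCount]

lemma quadPot_succ (s : ℕ → Bool) (n i : ℕ) :
    quadPot s n (i + 1) + quadInc s n i * (if s i then 1 else 0) =
      quadPot s n i + quadInc s n i * (if s i then 0 else 1) := by
  unfold quadPot quadInc
  rw [leftCount_succ, rightCount_succ]
  by_cases h : s i <;> by_cases h2 : rightCount s i ≤ n <;>
    simp only [h, h2, if_true, if_false, Bool.false_eq_true]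
  · obtain ⟨r, hr⟩ : ∃ r, n + 1 - rightCount s i = r + 1 := ⟨n - rightCount s i, by omega⟩
    have hr' : n + 1 - (rightCount s i + 1) = r := by omega
    rw [hr, hr']; ring
  · rw [show n + 1 - (rightCount s i + 1) = 0 by omega, show n + 1 - rightCount s i = 0 by omega]
  · simp only [add_zero]; ring
  · simp

lemma leftCount_le (s : ℕ → Bool) (n i : ℕ) : leftCount s n i ≤ i := by
  refine (Finset.sum_le_card_nsmul _ _ 1 fun j _ => ?_).trans (by simp)
  split_ifs <;> simp

lemma leftCount_congr {s t : ℕ → Bool} (n : ℕ) {i : ℕ} (h : ∀ j < i, s j = t j) :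
    leftCount s n i = leftCount t n i := by
  refine Finset.sum_congr rfl fun j hj => ?_
  have hj := Finset.mem_range.1 hj
  rw [h j hj, rightCount_congr fun k hk => h k (hk.trans hj)]

@[fun_prop]
lemma measurable_leftCount {α : Type*} [MeasurableSpace α] {f : α → ℕ → Bool}
    (hf : Measurable f) (n i : ℕ) : Measurable fun a => leftCount (f a) n i := by
  refine Finset.measurable_sum _ fun j _ => ?_
  exact Measurable.ite (((measurable_pi_apply j).comp hf) (measurableSet_singleton true))
    measurable_const (Measurable.ite (measurableSet_le (by fun_prop) measurable_const)
      measurable_const measurable_const)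

lemma leftsBefore_natCast (s : ℕ → Bool) (n : ℕ) :
    leftsBefore s n = ⨆ i, (leftCount s n i : ℝ≥0∞) := by
  rw [leftsBefore, ENNReal.tsum_eq_iSup_nat]
  refine iSup_congr fun i => ?_
  rw [leftCount, Nat.cast_sum]
  refine Finset.sum_congr rfl fun j _ => ?_
  simp only [usedInd, natCast_lt_add_one_iff]
  split_ifs <;> simp

lemma lintegral_quadPot_le {p : ℕ → ℝ} (hp : ∀ i, p i ∈ Icc (1 / 2 : ℝ) 1) (n i : ℕ) :
    ∫⁻ u, (quadPot (arrows p u) n i : ℝ≥0∞) ∂stackMeas ≤ ((n : ℝ≥0∞) + 1) ^ 2 + 2 * (n + 1) := by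
  induction i with
  | zero => simp [quadPot, leftCount, rightCount]
  | succ i ih =>
    refine le_trans ?_ ih
    have hcast : Measurable fun k : ℕ => (k : ℝ≥0∞) := measurable_of_countable _
    have hr : ∀ i, Measurable fun u => n + 1 - rightCount (arrows p u) i := fun i =>
      (measurable_of_countable fun k : ℕ => n + 1 - k).comp
        (measurable_rightCount (measurable_arrows measurable_const measurable_id) i)
    have hl : ∀ i, Measurable fun u => leftCount (arrows p u) n i := by fun_prop
    have hI : Measurable fun u => (quadInc (arrows p u) n i : ℝ≥0∞) := by
      refine hcast.comp (Measurable.ite (measurableSet_le (by fun_prop) measurable_const) ?_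
        measurable_const)
      exact (((hl i).add (hr i)).const_mul 2).add_const 1
    have hP : ∀ i, Measurable fun u => (quadPot (arrows p u) n i : ℝ≥0∞) := fun i =>
      hcast.comp ((((hl i).add (hr i)).pow_const 2).add ((hr i).const_mul 2))
    have hdep : ∀ u v : ℕ → ℝ, (∀ j < i, u j = v j) →
        (quadInc (arrows p u) n i : ℝ≥0∞) = quadInc (arrows p v) n i := fun u v h => by
      rw [quadInc, quadInc, leftCount_congr n (arrows_congr p h),
        rightCount_congr (arrows_congr p h)]
    have hpi : p i ∈ Icc (0 : ℝ) 1 := ⟨by linarith [(hp i).1], (hp i).2⟩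
    have key : ∫⁻ u, (quadPot (arrows p u) n (i + 1) : ℝ≥0∞) +
          quadInc (arrows p u) n i * (if arrows p u i then 1 else 0) ∂stackMeas =
        ∫⁻ u, (quadPot (arrows p u) n i : ℝ≥0∞) +
          quadInc (arrows p u) n i * (if arrows p u i then 0 else 1) ∂stackMeas := by
      refine lintegral_congr fun u => ?_
      have := quadPot_succ (arrows p u) n i
      exact_mod_cast this
    rw [lintegral_add_left (hP _), lintegral_add_left (hP _), lintegral_right hI hdep hpi,
      lintegral_left hI hdep hpi] at key
    have hfin : ∫⁻ u, (quadInc (arrows p u) n i : ℝ≥0∞) ∂stackMeas ≠ ⊤ := by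
      refine ne_top_of_le_ne_top (b := ((2 * (i + (n + 1)) + 1 : ℕ) : ℝ≥0∞))
        (ENNReal.natCast_ne_top _) ?_
      calc _ ≤ ∫⁻ _, ((2 * (i + (n + 1)) + 1 : ℕ) : ℝ≥0∞) ∂stackMeas := by
            refine lintegral_mono fun u => ?_
            rw [Nat.cast_le, quadInc]
            have := leftCount_le (arrows p u) n i
            split_ifs <;> omega
        _ = _ := by simp
    have hle : (∫⁻ u, (quadInc (arrows p u) n i : ℝ≥0∞) ∂stackMeas) * ENNReal.ofReal (1 - p i) ≤
        (∫⁻ u, (quadInc (arrows p u) n i : ℝ≥0∞) ∂stackMeas) * ENNReal.ofReal (p i) := by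
      gcongr
      linarith [(hp i).1]
    refine (ENNReal.add_le_add_iff_right (ENNReal.mul_ne_top hfin
      (ENNReal.ofReal_ne_top (r := p i)))).1 ?_
    exact key.le.trans (add_le_add_right hle _)

lemma lintegral_leftsBefore_sq_le {p : ℕ → ℝ} (hp : ∀ i, p i ∈ Icc (1 / 2 : ℝ) 1) {n : ℝ≥0∞}
    (hn : IsNatOrTop n) :
    ∫⁻ u, leftsBefore (arrows p u) n ^ 2 ∂stackMeas ≤ (n + 1) ^ 2 + 2 * (n + 1) := by
  rcases hn with rfl | ⟨n, rfl⟩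
  · simp
  have hmono : ∀ s, Monotone fun i => (leftCount s n i : ℝ≥0∞) ^ 2 := fun s =>
    monotone_nat_of_le_succ fun i => by rw [leftCount_succ]; gcongr; simp
  have hsq : ∀ u, leftsBefore (arrows p u) n ^ 2 =
      ⨆ i, (leftCount (arrows p u) n i : ℝ≥0∞) ^ 2 := fun u => by
    rw [leftsBefore_natCast]
    have h2 : Monotone fun a : ℝ≥0∞ => a ^ 2 := fun a b h => pow_le_pow_left' h 2
    exact h2.map_iSup_of_continuousAt (ENNReal.continuous_pow 2).continuousAt (by simp)
  simp_rw [hsq]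
  rw [lintegral_iSup]
  rotate_left 2
  · exact fun i j h u => hmono (arrows p u) h
  · refine iSup_le fun i => le_trans (lintegral_mono fun u => ?_) (lintegral_quadPot_le hp n i)
    have : leftCount (arrows p u) n i ^ 2 ≤ quadPot (arrows p u) n i := by
      exact (Nat.pow_le_pow_left (Nat.le_add_right _ _) 2).trans (Nat.le_add_right _ _)
    have h2 : ((leftCount (arrows p u) n i ^ 2 : ℕ) : ℝ≥0∞) ≤ quadPot (arrows p u) n i :=
      Nat.cast_le.2 this
    rwa [Nat.cast_pow] at h2
  · intro i
    exact ((measurable_of_countable fun k : ℕ => (k : ℝ≥0∞)).comp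
      (measurable_leftCount (measurable_arrows measurable_const measurable_id) n i)).pow_const 2

/-- The law of the uniform variables of a sequence of independent stacks. -/
def seqMeas : Measure (ℕ → ℕ → ℝ) := Measure.infinitePi fun _ => stackMeas

instance : IsProbabilityMeasure seqMeas := by unfold seqMeas; infer_instance

/-- Prepending a term to a sequence. -/
def consSeq {α : Type*} (a : α) (v : ℕ → α) : ℕ → α
  | 0 => a
  | n + 1 => v n

@[fun_prop]
lemma measurable_consSeq {α β : Type*} [MeasurableSpace α] [MeasurableSpace β] {f : β → α}
    {g : β → ℕ → α} (hf : Measurable f) (hg : Measurable g) :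
    Measurable fun b => consSeq (f b) (g b) := by
  refine measurable_pi_iff.2 fun n => ?_
  cases n with
  | zero => exact hf
  | succ n => exact (measurable_pi_apply n).comp hg

@[fun_prop]
lemma measurable_shiftSeq {α : Type*} [MeasurableSpace α] :
    Measurable (shiftSeq : (ℕ → α) → ℕ → α) :=
  measurable_pi_iff.2 fun n => measurable_pi_apply (n + 1)

lemma map_consSeq :
    (stackMeas.prod seqMeas).map (fun q => consSeq q.1 q.2) = seqMeas := by
  classical
  have hm : Measurable fun q : (ℕ → ℝ) × (ℕ → ℕ → ℝ) => consSeq q.1 q.2 := by fun_prop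
  refine Measure.eq_infinitePi _ fun s t ht => ?_
  obtain ⟨n, hn⟩ := s.exists_nat_subset_range
  set t' : ℕ → Set (ℕ → ℝ) := fun i => if i ∈ s then t i else univ with ht'
  have ht'm : ∀ i, MeasurableSet (t' i) := fun i => by
    simp only [ht']; split_ifs with h
    · exact ht i
    · exact MeasurableSet.univ
  have hset : Set.pi s t = Set.pi (Finset.range (n + 1)) t' := by
    ext u
    simp only [Set.mem_pi, Finset.mem_coe, ht']
    constructor
    · intro h i _
      split_ifs with his
      · exact h i his
      · trivial
    · intro h i his
      have := h i (Finset.mem_range.2 ((Finset.mem_range.1 (hn his)).trans n.lt_succ_self))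
      rwa [if_pos his] at this
  have hprod : ∏ i ∈ s, stackMeas (t i) = ∏ i ∈ Finset.range (n + 1), stackMeas (t' i) := by
    rw [← Finset.prod_subset (hn.trans (Finset.range_subset_range.2 n.le_succ))]
    · exact Finset.prod_congr rfl fun i hi => by simp [ht', hi]
    · intro i _ hi; simp [ht', hi]
  have hpre : (fun q : (ℕ → ℝ) × (ℕ → ℕ → ℝ) => consSeq q.1 q.2) ⁻¹'
      (Set.pi (Finset.range (n + 1)) t') =
      t' 0 ×ˢ Set.pi (Finset.range n) fun i => t' (i + 1) := by
    ext ⟨v, w⟩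
    simp only [mem_preimage, Set.mem_pi, Finset.mem_coe, Finset.mem_range, mem_prod]
    constructor
    · exact fun h => ⟨h 0 (by omega), fun i hi => h (i + 1) (by omega)⟩
    · rintro ⟨h0, h1⟩ i hi
      cases i with
      | zero => exact h0
      | succ i => exact h1 i (by omega)
  rw [hset, hprod, Measure.map_apply hm (.pi (Finset.countable_toSet _) fun i _ => ht'm i), hpre,
    Measure.prod_prod, seqMeas, Measure.infinitePi_pi _ fun i _ => ht'm _,
    Finset.prod_range_succ', mul_comm]

lemma lintegral_seqMeas {G : (ℕ → ℝ) → (ℕ → ℕ → ℝ) → ℝ≥0∞} (hG : Measurable (Function.uncurry G)) :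
    ∫⁻ u, G (u 0) (shiftSeq u) ∂seqMeas = ∫⁻ w, ∫⁻ v, G v w ∂stackMeas ∂seqMeas := by
  have h1 : Measurable fun u : ℕ → ℕ → ℝ => G (u 0) (shiftSeq u) :=
    hG.comp (f := fun u : ℕ → ℕ → ℝ => (u 0, shiftSeq u)) (by fun_prop)
  conv_lhs => rw [← map_consSeq]
  rw [lintegral_map h1 (by fun_prop)]
  have h2 : ∀ q : (ℕ → ℝ) × (ℕ → ℕ → ℝ), G (consSeq q.1 q.2 0) (shiftSeq (consSeq q.1 q.2)) =
      Function.uncurry G q := fun q => rfl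
  simp_rw [h2]
  rw [lintegral_prod_symm _ hG.aemeasurable]
  rfl

lemma measurePreserving_shiftSeq_seqMeas : MeasurePreserving shiftSeq seqMeas seqMeas := by
  refine ⟨measurable_shiftSeq, ?_⟩
  exact Measure.map_infinitePi_infinitePi_of_inj (P := fun _ : ℕ => stackMeas)
    (f := fun n : ℕ => n + 1) (add_left_injective 1)

/-- The stacks of instructions at the sites `0, 1, 2, …`. -/
def bits (e u : ℕ → ℕ → ℝ) : ℕ → ℕ → Bool := fun z => arrows (e z) (u z)

@[fun_prop]
lemma measurable_bits {α : Type*} [MeasurableSpace α] {f g : α → ℕ → ℕ → ℝ} (hf : Measurable f)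
    (hg : Measurable g) : Measurable fun a => bits (f a) (g a) :=
  measurable_pi_iff.2 fun z => by unfold bits; fun_prop

/-- The number of left steps from site `0` before the first visit to `K`, for a walk driven by
the stacks `b` and started at or to the left of `0`. -/
def leftSteps : ℕ → (ℕ → ℕ → Bool) → ℝ≥0∞
  | 0, _ => 0
  | K + 1, b => leftsBefore (b 0) (leftSteps K (shiftSeq b))

/-- The total number of left steps from site `0`. -/
def leftStepsTotal (b : ℕ → ℕ → Bool) : ℝ≥0∞ := ⨆ K, leftSteps K b

lemma leftSteps_isNatOrTop (K : ℕ) (b : ℕ → ℕ → Bool) : IsNatOrTop (leftSteps K b) := by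
  cases K with
  | zero => exact Or.inr ⟨0, by simp [leftSteps]⟩
  | succ K => exact leftsBefore_isNatOrTop _ _

lemma leftSteps_mono (b : ℕ → ℕ → Bool) : Monotone fun K => leftSteps K b := by
  refine monotone_nat_of_le_succ fun K => ?_
  induction K generalizing b with
  | zero => simp [leftSteps]
  | succ K ih => exact leftsBefore_mono _ (ih _)

@[fun_prop]
lemma measurable_leftSteps {α : Type*} [MeasurableSpace α] {f : α → ℕ → ℕ → Bool}
    (hf : Measurable f) (K : ℕ) : Measurable fun a => leftSteps K (f a) := by
  induction K generalizing f with
  | zero => exact measurable_const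
  | succ K ih =>
    exact measurable_leftsBefore ((measurable_pi_apply 0).comp hf)
      (ih (measurable_shiftSeq.comp hf))

@[fun_prop]
lemma measurable_leftStepsTotal {α : Type*} [MeasurableSpace α] {f : α → ℕ → ℕ → Bool}
    (hf : Measurable f) : Measurable fun a => leftStepsTotal (f a) :=
  Measurable.iSup fun K => measurable_leftSteps hf K

lemma leftStepsTotal_eq (b : ℕ → ℕ → Bool) :
    leftStepsTotal b = leftsBefore (b 0) (leftStepsTotal (shiftSeq b)) := by
  rw [leftStepsTotal, leftStepsTotal, leftsBefore_iSup _ (leftSteps_mono _)]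
  refine le_antisymm (iSup_le fun K => ?_)
    (iSup_le fun K => le_iSup (fun K => leftSteps K b) (K + 1))
  exact (leftSteps_mono b K.le_succ).trans
    (le_iSup (fun K => leftsBefore (b 0) (leftSteps K (shiftSeq b))) K)

lemma leftStepsTotal_isNatOrTop (b : ℕ → ℕ → Bool) : IsNatOrTop (leftStepsTotal b) := by
  rw [leftStepsTotal_eq]
  exact leftsBefore_isNatOrTop _ _

lemma lintegral_first_stack {ρ : Measure (ℕ → ℕ → ℝ)} [SFinite ρ]
    {f : (ℕ → ℝ) → (ℕ → Bool) → ℝ≥0∞ → ℝ≥0∞}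
    (hf : Measurable fun q : (ℕ → ℝ) × (ℕ → Bool) × ℝ≥0∞ => f q.1 q.2.1 q.2.2)
    {N : (ℕ → ℕ → Bool) → ℝ≥0∞} (hN : Measurable N) :
    ∫⁻ q, f (q.1 0) (bits q.1 q.2 0) (N (shiftSeq (bits q.1 q.2))) ∂(ρ.prod seqMeas) =
      ∫⁻ q, ∫⁻ v, f (q.1 0) (arrows (q.1 0) v) (N (bits (shiftSeq q.1) q.2)) ∂stackMeas
        ∂(ρ.prod seqMeas) := by
  have h1 : Measurable fun q : (ℕ → ℕ → ℝ) × (ℕ → ℕ → ℝ) =>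
      f (q.1 0) (bits q.1 q.2 0) (N (shiftSeq (bits q.1 q.2))) :=
    hf.comp (f := fun q : (ℕ → ℕ → ℝ) × (ℕ → ℕ → ℝ) =>
      (q.1 0, bits q.1 q.2 0, N (shiftSeq (bits q.1 q.2))))
      (.prodMk (by fun_prop) (.prodMk
        ((measurable_pi_apply 0).comp (measurable_bits measurable_fst measurable_snd))
        (hN.comp (measurable_shiftSeq.comp (measurable_bits measurable_fst measurable_snd)))))
  have h2 : Measurable fun r : ((ℕ → ℕ → ℝ) × (ℕ → ℕ → ℝ)) × (ℕ → ℝ) =>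
      f (r.1.1 0) (arrows (r.1.1 0) r.2) (N (bits (shiftSeq r.1.1) r.1.2)) :=
    hf.comp (f := fun r : ((ℕ → ℕ → ℝ) × (ℕ → ℕ → ℝ)) × (ℕ → ℝ) =>
      (r.1.1 0, arrows (r.1.1 0) r.2, N (bits (shiftSeq r.1.1) r.1.2)))
      (.prodMk (by fun_prop) (.prodMk
        (measurable_arrows (by fun_prop) (by fun_prop))
        (hN.comp (measurable_bits (measurable_shiftSeq.comp (by fun_prop)) (by fun_prop)))))
  rw [lintegral_prod _ h1.aemeasurable, lintegral_prod _ h2.lintegral_prod_right'.aemeasurable]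
  refine lintegral_congr fun e => ?_
  exact lintegral_seqMeas
    (G := fun v w => f (e 0) (arrows (e 0) v) (N (bits (shiftSeq e) w)))
    (h2.comp (f := fun r : (ℕ → ℝ) × (ℕ → ℕ → ℝ) => ((e, r.2), r.1)) (by fun_prop))

lemma lintegral_shift_env {ρ : Measure (ℕ → ℕ → ℝ)} [SFinite ρ]
    (hst : MeasurePreserving shiftSeq ρ ρ) {g : (ℕ → ℕ → Bool) → ℝ≥0∞} (hg : Measurable g) :
    ∫⁻ q, g (bits (shiftSeq q.1) q.2) ∂(ρ.prod seqMeas) =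
      ∫⁻ q, g (bits q.1 q.2) ∂(ρ.prod seqMeas) :=
  (hst.prod (.id seqMeas)).lintegral_comp (f := fun q => g (bits q.1 q.2))
    (hg.comp (measurable_bits measurable_fst measurable_snd))

lemma ae_env {ρ : Measure (ℕ → ℕ → ℝ)} [SFinite ρ]
    (hρ : ∀ᵐ e ∂ρ, ∀ z i, e z i ∈ Icc (1 / 2 : ℝ) 1) :
    ∀ᵐ q ∂(ρ.prod seqMeas), ∀ z i, q.1 z i ∈ Icc (1 / 2 : ℝ) 1 :=
  Measure.quasiMeasurePreserving_fst.ae hρ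

lemma lintegral_leftSteps_succ_add {ρ : Measure (ℕ → ℕ → ℝ)} [IsProbabilityMeasure ρ]
    (hρ : ∀ᵐ e ∂ρ, ∀ z i, e z i ∈ Icc (1 / 2 : ℝ) 1) (hst : MeasurePreserving shiftSeq ρ ρ)
    (K : ℕ) :
    ∫⁻ q, leftSteps (K + 1) (bits q.1 q.2) ∂(ρ.prod seqMeas) +
      ∫⁻ q, driftBefore (q.1 0) (bits q.1 q.2 0) (leftSteps K (shiftSeq (bits q.1 q.2)))
        ∂(ρ.prod seqMeas) =
      ∫⁻ q, leftSteps K (bits q.1 q.2) ∂(ρ.prod seqMeas) + 1 := by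
  have h1 : Measurable fun q : (ℕ → ℕ → ℝ) × (ℕ → ℕ → ℝ) => leftSteps (K + 1) (bits q.1 q.2) :=
    measurable_leftSteps (measurable_bits measurable_fst measurable_snd) _
  rw [← lintegral_add_left h1]
  have hK : Measurable (leftSteps K) := measurable_leftSteps measurable_id K
  refine (lintegral_first_stack (f := fun p s n => leftsBefore s n + driftBefore p s n)
    (by fun_prop) hK).trans ?_
  have h2 : ∀ᵐ q ∂(ρ.prod seqMeas), ∫⁻ v, leftsBefore (arrows (q.1 0) v)
      (leftSteps K (bits (shiftSeq q.1) q.2)) + driftBefore (q.1 0) (arrows (q.1 0) v)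
      (leftSteps K (bits (shiftSeq q.1) q.2)) ∂stackMeas =
      leftSteps K (bits (shiftSeq q.1) q.2) + 1 := by
    filter_upwards [ae_env hρ] with q hq
    exact lintegral_leftsBefore_add_driftBefore_eq (hq 0) (leftSteps_isNatOrTop _ _)
  rw [lintegral_congr_ae h2, lintegral_add_right _ measurable_const, lintegral_one, measure_univ]
  congr 1
  exact lintegral_shift_env hst hK

lemma lintegral_leftSteps_le {ρ : Measure (ℕ → ℕ → ℝ)} [IsProbabilityMeasure ρ]
    (hρ : ∀ᵐ e ∂ρ, ∀ z i, e z i ∈ Icc (1 / 2 : ℝ) 1) (hst : MeasurePreserving shiftSeq ρ ρ)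
    (K : ℕ) : ∫⁻ q, leftSteps K (bits q.1 q.2) ∂(ρ.prod seqMeas) ≤ K := by
  induction K with
  | zero => simp [leftSteps]
  | succ K ih =>
    have := (le_self_add.trans (lintegral_leftSteps_succ_add hρ hst K).le)
    refine this.trans ?_
    push_cast
    gcongr

/-- The expected drift consumed at the first site. -/
def meanDrift (ρ : Measure (ℕ → ℕ → ℝ)) : ℝ≥0∞ :=
  ∫⁻ q, driftBefore (q.1 0) (bits q.1 q.2 0) (leftStepsTotal (shiftSeq (bits q.1 q.2)))
    ∂(ρ.prod seqMeas)

lemma measurable_drift_leftSteps (K : ℕ) :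
    Measurable fun q : (ℕ → ℕ → ℝ) × (ℕ → ℕ → ℝ) =>
      driftBefore (q.1 0) (bits q.1 q.2 0) (leftSteps K (shiftSeq (bits q.1 q.2))) :=
  measurable_driftBefore (by fun_prop)
    ((measurable_pi_apply 0).comp (measurable_bits measurable_fst measurable_snd))
    (measurable_leftSteps (measurable_shiftSeq.comp (measurable_bits measurable_fst measurable_snd))
      K)

lemma meanDrift_eq_iSup (ρ : Measure (ℕ → ℕ → ℝ)) : meanDrift ρ = ⨆ K,
    ∫⁻ q, driftBefore (q.1 0) (bits q.1 q.2 0) (leftSteps K (shiftSeq (bits q.1 q.2)))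
      ∂(ρ.prod seqMeas) := by
  rw [← lintegral_iSup measurable_drift_leftSteps]
  · unfold meanDrift leftStepsTotal
    simp_rw [driftBefore_iSup _ _ (leftSteps_mono _)]
  · exact fun i j h q => driftBefore_mono _ _ (leftSteps_mono _ h)

lemma meanDrift_le_one {ρ : Measure (ℕ → ℕ → ℝ)} [IsProbabilityMeasure ρ]
    (hρ : ∀ᵐ e ∂ρ, ∀ z i, e z i ∈ Icc (1 / 2 : ℝ) 1) (hst : MeasurePreserving shiftSeq ρ ρ) :
    meanDrift ρ ≤ 1 := by
  rw [meanDrift_eq_iSup]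
  refine iSup_le fun K => ?_
  have h1 := lintegral_leftSteps_succ_add hρ hst K
  have hfin : ∫⁻ q, leftSteps K (bits q.1 q.2) ∂(ρ.prod seqMeas) ≠ ⊤ :=
    ne_top_of_le_ne_top (ENNReal.natCast_ne_top K) (lintegral_leftSteps_le hρ hst K)
  have h2 : ∫⁻ q, leftSteps K (bits q.1 q.2) ∂(ρ.prod seqMeas) ≤
      ∫⁻ q, leftSteps (K + 1) (bits q.1 q.2) ∂(ρ.prod seqMeas) :=
    lintegral_mono fun q => leftSteps_mono _ K.le_succ
  refine (ENNReal.add_le_add_iff_left hfin).1 ?_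
  rw [← h1]
  gcongr

lemma driftBefore_top (p : ℕ → ℝ) (s : ℕ → Bool) :
    driftBefore p s ⊤ = ∑' i, ENNReal.ofReal (2 * p i - 1) := by
  simp [driftBefore, usedInd]

lemma lintegral_fst_seqMeas {ρ : Measure (ℕ → ℕ → ℝ)} [SFinite ρ] {g : (ℕ → ℕ → ℝ) → ℝ≥0∞}
    (hg : Measurable g) : ∫⁻ q, g q.1 ∂(ρ.prod seqMeas) = ∫⁻ e, g e ∂ρ := by
  rw [lintegral_prod (fun q => g q.1) (hg.comp measurable_fst).aemeasurable]
  simp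

lemma measurable_stackDrift :
    Measurable fun e : ℕ → ℕ → ℝ => ∑' i, ENNReal.ofReal (2 * e 0 i - 1) :=
  Measurable.tsum fun i => by fun_prop

lemma meanDrift_le_stackDrift (ρ : Measure (ℕ → ℕ → ℝ)) [SFinite ρ] :
    meanDrift ρ ≤ ∫⁻ e, ∑' i, ENNReal.ofReal (2 * e 0 i - 1) ∂ρ := by
  rw [← lintegral_fst_seqMeas measurable_stackDrift]
  refine lintegral_mono fun q => ?_
  rw [← driftBefore_top (q.1 0) (bits q.1 q.2 0)]
  exact driftBefore_mono _ _ le_top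

lemma meanDrift_eq_stackDrift {ρ : Measure (ℕ → ℕ → ℝ)} [SFinite ρ]
    (h : ∀ᵐ q ∂(ρ.prod seqMeas), leftStepsTotal (shiftSeq (bits q.1 q.2)) = ⊤) :
    meanDrift ρ = ∫⁻ e, ∑' i, ENNReal.ofReal (2 * e 0 i - 1) ∂ρ := by
  rw [← lintegral_fst_seqMeas measurable_stackDrift]
  refine lintegral_congr_ae ?_
  filter_upwards [h] with q hq
  rw [hq, driftBefore_top]

lemma lintegral_leftSteps_sq_succ_le {ρ : Measure (ℕ → ℕ → ℝ)} [IsProbabilityMeasure ρ]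
    (hρ : ∀ᵐ e ∂ρ, ∀ z i, e z i ∈ Icc (1 / 2 : ℝ) 1) (hst : MeasurePreserving shiftSeq ρ ρ)
    (K : ℕ) :
    ∫⁻ q, leftSteps (K + 1) (bits q.1 q.2) ^ 2 ∂(ρ.prod seqMeas) ≤
      ∫⁻ q, leftSteps K (bits q.1 q.2) ^ 2 ∂(ρ.prod seqMeas) +
        4 * ∫⁻ q, leftSteps K (bits q.1 q.2) ∂(ρ.prod seqMeas) + 3 := by
  have hm : Measurable fun q : (ℕ → ℕ → ℝ) × (ℕ → ℕ → ℝ) => leftSteps K (bits q.1 q.2) :=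
    measurable_leftSteps (measurable_bits measurable_fst measurable_snd) _
  have hK : Measurable (leftSteps K) := measurable_leftSteps measurable_id K
  calc _ = _ := lintegral_first_stack (f := fun p s n => leftsBefore s n ^ 2)
        (by fun_prop) hK
    _ ≤ ∫⁻ q, leftSteps K (bits (shiftSeq q.1) q.2) ^ 2 +
        4 * leftSteps K (bits (shiftSeq q.1) q.2) + 3 ∂(ρ.prod seqMeas) := by
      refine lintegral_mono_ae ?_
      filter_upwards [ae_env hρ] with q hq
      refine (lintegral_leftsBefore_sq_le (hq 0) (leftSteps_isNatOrTop _ _)).trans_eq ?_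
      ring
    _ = ∫⁻ q, leftSteps K (bits q.1 q.2) ^ 2 + 4 * leftSteps K (bits q.1 q.2) + 3
        ∂(ρ.prod seqMeas) :=
      lintegral_shift_env hst (g := fun b => leftSteps K b ^ 2 + 4 * leftSteps K b + 3)
        (by fun_prop)
    _ = _ := by
      rw [lintegral_add_right _ measurable_const, lintegral_add_left (hm.pow_const 2),
        lintegral_const_mul _ hm]
      simp

lemma lintegral_leftSteps_sq_le {ρ : Measure (ℕ → ℕ → ℝ)} [IsProbabilityMeasure ρ]
    (hρ : ∀ᵐ e ∂ρ, ∀ z i, e z i ∈ Icc (1 / 2 : ℝ) 1) (hst : MeasurePreserving shiftSeq ρ ρ)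
    (K : ℕ) :
    ∫⁻ q, leftSteps K (bits q.1 q.2) ^ 2 ∂(ρ.prod seqMeas) ≤ 2 * (K : ℝ≥0∞) ^ 2 + K := by
  induction K with
  | zero => simp [leftSteps]
  | succ K ih =>
    refine (lintegral_leftSteps_sq_succ_le hρ hst K).trans ?_
    have := lintegral_leftSteps_le hρ hst K
    calc _ ≤ 2 * (K : ℝ≥0∞) ^ 2 + K + 4 * K + 3 := by gcongr
      _ = _ := by push_cast; ring

lemma mul_le_lintegral_leftSteps {ρ : Measure (ℕ → ℕ → ℝ)} [IsProbabilityMeasure ρ]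
    (hρ : ∀ᵐ e ∂ρ, ∀ z i, e z i ∈ Icc (1 / 2 : ℝ) 1) (hst : MeasurePreserving shiftSeq ρ ρ)
    (K : ℕ) :
    (K : ℝ≥0∞) ≤ ∫⁻ q, leftSteps K (bits q.1 q.2) ∂(ρ.prod seqMeas) + K * meanDrift ρ := by
  induction K with
  | zero => simp
  | succ K ih =>
    have h1 := lintegral_leftSteps_succ_add hρ hst K
    calc ((K + 1 : ℕ) : ℝ≥0∞) = K + 1 := by push_cast; rfl
      _ ≤ ∫⁻ q, leftSteps K (bits q.1 q.2) ∂(ρ.prod seqMeas) + K * meanDrift ρ + 1 := by gcongr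
      _ = (∫⁻ q, leftSteps K (bits q.1 q.2) ∂(ρ.prod seqMeas) + 1) + K * meanDrift ρ := by ring
      _ ≤ (∫⁻ q, leftSteps (K + 1) (bits q.1 q.2) ∂(ρ.prod seqMeas) + meanDrift ρ) +
          K * meanDrift ρ := by
        rw [← h1, meanDrift_eq_iSup]
        gcongr
        exact le_iSup (fun K => ∫⁻ q, driftBefore (q.1 0) (bits q.1 q.2 0)
          (leftSteps K (shiftSeq (bits q.1 q.2))) ∂(ρ.prod seqMeas)) K
      _ = _ := by push_cast; ring

/-- If the total number of left steps is almost surely finite, then its truncations cannot have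
linearly growing expectations, as their second moments grow at most quadratically. -/
lemma one_le_meanDrift {ρ : Measure (ℕ → ℕ → ℝ)} [IsProbabilityMeasure ρ]
    (hρ : ∀ᵐ e ∂ρ, ∀ z i, e z i ∈ Icc (1 / 2 : ℝ) 1) (hst : MeasurePreserving shiftSeq ρ ρ)
    (h : ∀ᵐ q ∂(ρ.prod seqMeas), leftStepsTotal (bits q.1 q.2) ≠ ⊤) :
    1 ≤ meanDrift ρ := by
  by_contra hc
  rw [not_le] at hc
  have hc' : meanDrift ρ ≠ ⊤ := hc.ne_top
  set c := (meanDrift ρ).toReal with hcdef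
  have hcE : meanDrift ρ = ENNReal.ofReal c := (ENNReal.ofReal_toReal hc').symm
  have hc0 : 0 ≤ c := ENNReal.toReal_nonneg
  have hc1 : c < 1 := by
    rw [hcE] at hc
    by_contra hcon
    exact absurd hc (not_lt.2 (by simpa using ENNReal.ofReal_le_ofReal (not_lt.1 hcon)))
  set ε := 1 - c with hε
  have hε0 : 0 < ε := by linarith
  have hZ : Measurable fun q : (ℕ → ℕ → ℝ) × (ℕ → ℕ → ℝ) => leftStepsTotal (bits q.1 q.2) :=
    measurable_leftStepsTotal (measurable_bits measurable_fst measurable_snd)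
  obtain ⟨L, hL⟩ : ∃ L : ℕ, (ρ.prod seqMeas) {q | (L : ℝ≥0∞) < leftStepsTotal (bits q.1 q.2)} ≤
      ENNReal.ofReal (ε ^ 2 / 48) := by
    have htend := tendsto_measure_iInter_atTop (μ := ρ.prod seqMeas)
      (s := fun L : ℕ => {q | (L : ℝ≥0∞) < leftStepsTotal (bits q.1 q.2)})
      (fun L => (measurableSet_lt measurable_const hZ).nullMeasurableSet)
      (fun i j hij q (hq : (j : ℝ≥0∞) < _) =>
        show (i : ℝ≥0∞) < _ from lt_of_le_of_lt (Nat.cast_le.2 hij) hq) ⟨0, measure_ne_top _ _⟩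
    have hnull : (ρ.prod seqMeas) (⋂ L : ℕ,
        {q | (L : ℝ≥0∞) < leftStepsTotal (bits q.1 q.2)}) = 0 := by
      refine measure_mono_null (fun q hq => ?_) h
      simp only [mem_compl_iff, mem_ofPred_eq, not_not]
      by_contra hne
      obtain ⟨k, hk⟩ := ENNReal.exists_nat_gt hne
      exact absurd (mem_iInter.1 hq k) (not_lt.2 hk.le)
    rw [hnull] at htend
    exact (htend.eventually_le_const (ENNReal.ofReal_pos.2 (by positivity))).exists
  set A := {q : (ℕ → ℕ → ℝ) × (ℕ → ℕ → ℝ) | (L : ℝ≥0∞) < leftStepsTotal (bits q.1 q.2)} with hA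
  have hAm : MeasurableSet A := measurableSet_lt measurable_const hZ
  have hamgm : ∀ (z t : ℝ≥0∞), t ≠ 0 → t ≠ ⊤ → z ≤ t * z ^ 2 + t⁻¹ := by
    intro z t h0 h1
    rcases le_total z t⁻¹ with hz | hz
    · exact hz.trans le_add_self
    · refine le_trans ?_ le_self_add
      calc z = t * t⁻¹ * z := by rw [ENNReal.mul_inv_cancel h0 h1, one_mul]
        _ ≤ t * z * z := by gcongr
        _ = _ := by ring
  have hbound : ∀ K : ℕ, 0 < K → (K : ℝ) * (ε / 2) ≤ L := by
    intro K hK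
    have hK' : (1 : ℝ) ≤ K := by exact_mod_cast hK
    set t : ℝ := ε / 12 / K with ht
    have ht0 : 0 < t := by positivity
    have hm : Measurable fun q : (ℕ → ℕ → ℝ) × (ℕ → ℕ → ℝ) => leftSteps K (bits q.1 q.2) :=
      measurable_leftSteps (measurable_bits measurable_fst measurable_snd) _
    have h_int : ∫⁻ q, leftSteps K (bits q.1 q.2) ∂(ρ.prod seqMeas) ≤
        ENNReal.ofReal (L + t * (2 * K ^ 2 + K) + t⁻¹ * (ε ^ 2 / 48)) := by
      calc _ ≤ ∫⁻ q, ((L : ℝ≥0∞) + ENNReal.ofReal t * leftSteps K (bits q.1 q.2) ^ 2) +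
            A.indicator (fun _ => (ENNReal.ofReal t)⁻¹) q ∂(ρ.prod seqMeas) := by
            refine lintegral_mono fun q => ?_
            by_cases hq : q ∈ A
            · simp only [indicator_of_mem hq, add_assoc]
              exact (hamgm _ _ (by simpa using ht0) ENNReal.ofReal_ne_top).trans le_add_self
            · simp only [indicator_of_notMem hq, add_zero]
              refine le_trans ?_ le_self_add
              exact (le_iSup (fun K => leftSteps K (bits q.1 q.2)) K).trans (not_lt.1 hq)
        _ = (L : ℝ≥0∞) + ENNReal.ofReal t * ∫⁻ q, leftSteps K (bits q.1 q.2) ^ 2 ∂(ρ.prod seqMeas)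
            + (ENNReal.ofReal t)⁻¹ * (ρ.prod seqMeas) A := by
            rw [lintegral_add_right _ (measurable_const.indicator hAm),
              lintegral_add_left measurable_const, lintegral_const_mul _ (hm.pow_const 2),
              lintegral_indicator_const hAm]
            simp
        _ ≤ (L : ℝ≥0∞) + ENNReal.ofReal t * (2 * (K : ℝ≥0∞) ^ 2 + K)
            + (ENNReal.ofReal t)⁻¹ * ENNReal.ofReal (ε ^ 2 / 48) := by
            gcongr
            exact lintegral_leftSteps_sq_le hρ hst K
        _ = _ := by
            rw [ENNReal.ofReal_add (by positivity) (by positivity),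
              ENNReal.ofReal_add (by positivity) (by positivity), ENNReal.ofReal_mul ht0.le,
              ENNReal.ofReal_mul (by positivity : (0 : ℝ) ≤ t⁻¹), ENNReal.ofReal_inv_of_pos ht0,
              ENNReal.ofReal_natCast, ENNReal.ofReal_add (by positivity) (by positivity),
              ENNReal.ofReal_mul (by norm_num), ENNReal.ofReal_pow (by positivity),
              ENNReal.ofReal_natCast]
            simp
    have h1 : (K : ℝ≥0∞) ≤
        ENNReal.ofReal (L + t * (2 * K ^ 2 + K) + t⁻¹ * (ε ^ 2 / 48) + K * c) := by
      refine (mul_le_lintegral_leftSteps hρ hst K).trans ?_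
      rw [ENNReal.ofReal_add (by positivity) (by positivity), hcE,
        ENNReal.ofReal_mul (by positivity : (0 : ℝ) ≤ K), ENNReal.ofReal_natCast]
      gcongr
    rw [← ENNReal.ofReal_natCast, ENNReal.ofReal_le_ofReal_iff (by positivity)] at h1
    have h2 : t * (2 * K ^ 2 + K) ≤ K * (ε / 4) := by
      have : t * (2 * K ^ 2 + K) = ε / 12 * (2 * K + 1) := by
        rw [ht]; field_simp
      rw [this]; nlinarith
    have h3 : t⁻¹ * (ε ^ 2 / 48) = K * (ε / 4) := by
      rw [ht]; field_simp; norm_num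
    have h4 : (K : ℝ) * c = K - K * ε := by rw [hε]; ring
    linarith
  obtain ⟨K, hK⟩ := exists_nat_gt (L / (ε / 2))
  have := hbound (K + 1) K.succ_pos
  rw [div_lt_iff₀ (by positivity)] at hK
  push_cast at this
  nlinarith

lemma iterate_shiftSeq {α : Type*} (k : ℕ) (u : ℕ → α) :
    shiftSeq^[k] u = fun i => u (i + k) := by
  induction k generalizing u with
  | zero => rfl
  | succ k ih => rw [Function.iterate_succ_apply, ih]; funext i; simp only [shiftSeq]; congr 1

/-- The pairs of cookie strengths and uniform variables producing infinitely many left steps. -/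
def infiniteLeft : Set ((ℕ → ℕ → ℝ) × (ℕ → ℕ → ℝ)) := {q | leftStepsTotal (bits q.1 q.2) = ⊤}

lemma measurableSet_infiniteLeft : MeasurableSet infiniteLeft :=
  measurable_leftStepsTotal (measurable_bits measurable_fst measurable_snd)
    (measurableSet_singleton ⊤)

lemma ae_leftsBefore_ne_top {ρ : Measure (ℕ → ℕ → ℝ)} [IsProbabilityMeasure ρ]
    (hρ : ∀ᵐ e ∂ρ, ∀ z i, e z i ∈ Icc (1 / 2 : ℝ) 1) (n : ℕ) :
    ∀ᵐ q ∂(ρ.prod seqMeas), leftsBefore (bits q.1 q.2 0) n ≠ ⊤ := by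
  have h1 : Measurable fun q : (ℕ → ℕ → ℝ) × (ℕ → ℕ → ℝ) => leftsBefore (bits q.1 q.2 0) n :=
    measurable_leftsBefore
      ((measurable_pi_apply 0).comp (measurable_bits measurable_fst measurable_snd))
      measurable_const
  have h2 : ∫⁻ q, leftsBefore (bits q.1 q.2 0) n ∂(ρ.prod seqMeas) ≠ ⊤ := by
    refine ne_top_of_le_ne_top (b := (n + 1 : ℝ≥0∞)) (by simp) ?_
    calc _ = _ := lintegral_first_stack (f := fun _ s _ => leftsBefore s n) (N := fun _ => 0)
          (by fun_prop) measurable_const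
      _ ≤ ∫⁻ _, ((n : ℝ≥0∞) + 1) ∂(ρ.prod seqMeas) := by
          refine lintegral_mono_ae ?_
          filter_upwards [ae_env hρ] with q hq
          rw [← lintegral_leftsBefore_add_driftBefore_eq (hq 0) (Or.inr ⟨n, rfl⟩)]
          exact lintegral_mono fun u => le_self_add
      _ = _ := by simp
  filter_upwards [ae_lt_top h1 h2] with q hq using hq.ne

lemma infiniteLeft_ae_eq {ρ : Measure (ℕ → ℕ → ℝ)} [IsProbabilityMeasure ρ]
    (hρ : ∀ᵐ e ∂ρ, ∀ z i, e z i ∈ Icc (1 / 2 : ℝ) 1) (hst : MeasurePreserving shiftSeq ρ ρ) :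
    infiniteLeft =ᵐ[ρ.prod seqMeas] Prod.map shiftSeq shiftSeq ⁻¹' infiniteLeft := by
  have hσ := hst.prod measurePreserving_shiftSeq_seqMeas
  refine ae_eq_of_ae_subset_of_measure_ge ?_ ?_ measurableSet_infiniteLeft.nullMeasurableSet
    (measure_ne_top _ _)
  · filter_upwards [ae_all_iff.2 (ae_leftsBefore_ne_top hρ)] with q hq hmem
    change leftStepsTotal (bits q.1 q.2) = ⊤ at hmem
    change leftStepsTotal (shiftSeq (bits q.1 q.2)) = ⊤
    rcases leftStepsTotal_isNatOrTop (shiftSeq (bits q.1 q.2)) with h | ⟨n, h⟩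
    · exact h
    · rw [leftStepsTotal_eq, h] at hmem
      exact absurd hmem (hq n)
  · exact (hσ.measure_preimage measurableSet_infiniteLeft.nullMeasurableSet).le

lemma seqMeas_eq_zero_or_one {e : ℕ → ℕ → ℝ}
    (he : ∀ k, ∀ᵐ u ∂seqMeas, (leftStepsTotal (bits e u) = ⊤ ↔
      leftStepsTotal (bits (shiftSeq^[k] e) (shiftSeq^[k] u)) = ⊤)) :
    seqMeas {u | leftStepsTotal (bits e u) = ⊤} = 0 ∨
      seqMeas {u | leftStepsTotal (bits e u) = ⊤} = 1 := by
  set A : ℕ → Set (ℕ → ℕ → ℝ) := fun k =>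
    {u | leftStepsTotal (bits (shiftSeq^[k] e) (shiftSeq^[k] u)) = ⊤} with hA
  let s : ℕ → MeasurableSpace (ℕ → ℕ → ℝ) := fun i =>
    MeasurableSpace.comap (fun u => u i) inferInstance
  have hind : iIndep s seqMeas :=
    (iIndepFun_infinitePi (P := fun _ : ℕ => stackMeas) (X := fun _ a => a) (by fun_prop)).iIndep
  have hmeas : ∀ n k, n ≤ k → MeasurableSet[⨆ i ≥ n, s i] (A k) := by
    intro n k hnk
    have h1 : @Measurable _ _ (⨆ i ≥ n, s i) _ (fun u : ℕ → ℕ → ℝ => shiftSeq^[k] u) := by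
      refine @measurable_pi_lambda _ _ _ (⨆ i ≥ n, s i) _ _ fun i => ?_
      simp only [iterate_shiftSeq]
      rw [measurable_iff_comap_le]
      exact le_iSup₂_of_le (f := fun i (_ : i ≥ n) => s i) (i + k) (by omega) le_rfl
    exact h1 (measurable_leftStepsTotal (measurable_bits measurable_const measurable_id)
      (measurableSet_singleton ⊤))
  set B : Set (ℕ → ℕ → ℝ) := limsup A atTop with hB
  have htail : MeasurableSet[limsup s atTop] B := by
    rw [hB, limsup_eq_iInf_iSup_of_nat, MeasurableSpace.measurableSet_iInf]
    intro n
    rw [← limsup_nat_add A n]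
    exact @MeasurableSet.measurableSet_limsup _ (⨆ i ≥ n, s i) _ fun k => hmeas n (k + n) (by omega)
  have hae : {u | leftStepsTotal (bits e u) = ⊤} =ᵐ[seqMeas] B := by
    refine eventuallyEq_set.2 ?_
    filter_upwards [ae_all_iff.2 he] with u hu
    rw [hB, limsup_eq_iInf_iSup_of_nat]
    simp only [iInf_eq_iInter, iSup_eq_iUnion, mem_iInter, mem_iUnion]
    constructor
    · exact fun h n => ⟨n, le_rfl, (hu n).1 h⟩
    · intro h
      obtain ⟨k, -, hk⟩ := h 0
      exact (hu k).2 hk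
  rw [measure_congr hae]
  exact measure_zero_or_one_of_measurableSet_limsup_atTop
    (fun n => (measurable_pi_apply n).comap_le) hind htail

lemma leftStepsTotal_zero_one {ρ : Measure (ℕ → ℕ → ℝ)} [IsProbabilityMeasure ρ]
    (hρ : ∀ᵐ e ∂ρ, ∀ z i, e z i ∈ Icc (1 / 2 : ℝ) 1) (herg : Ergodic shiftSeq ρ) :
    (∀ᵐ q ∂(ρ.prod seqMeas), leftStepsTotal (bits q.1 q.2) = ⊤) ∨
      ∀ᵐ q ∂(ρ.prod seqMeas), leftStepsTotal (bits q.1 q.2) ≠ ⊤ := by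
  have hst := herg.toMeasurePreserving
  have hσ := hst.prod measurePreserving_shiftSeq_seqMeas
  have hinv : ∀ k, ∀ᵐ q ∂(ρ.prod seqMeas), (q ∈ infiniteLeft ↔
      (Prod.map shiftSeq shiftSeq)^[k] q ∈ infiniteLeft) := by
    intro k
    induction k with
    | zero => exact ae_of_all _ fun q => Iff.rfl
    | succ k ih =>
      filter_upwards [ih, (hσ.iterate k).quasiMeasurePreserving.ae (infiniteLeft_ae_eq hρ hst)]
        with q h1 h2
      rw [h1, Function.iterate_succ_apply']
      exact h2.to_iff
  have hinv' : ∀ᵐ e ∂ρ, ∀ k, ∀ᵐ u ∂seqMeas, (leftStepsTotal (bits e u) = ⊤ ↔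
      leftStepsTotal (bits (shiftSeq^[k] e) (shiftSeq^[k] u)) = ⊤) := by
    rw [ae_all_iff]
    intro k
    have := Measure.ae_ae_of_ae_prod (hinv k)
    simpa only [Prod.map_iterate, Prod.map_apply, infiniteLeft, mem_ofPred_eq] using this
  set g : (ℕ → ℕ → ℝ) → ℝ≥0∞ := fun e => seqMeas {u | leftStepsTotal (bits e u) = ⊤} with hg
  have hgm : Measurable g := measurable_measure_prodMk_left measurableSet_infiniteLeft
  have hginv : g ∘ shiftSeq =ᵐ[ρ] g := by
    filter_upwards [hinv'] with e he
    have h1 : g (shiftSeq e) =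
        seqMeas (shiftSeq ⁻¹' {u | leftStepsTotal (bits (shiftSeq e) u) = ⊤}) :=
      (measurePreserving_shiftSeq_seqMeas.measure_preimage
        (measurable_leftStepsTotal (measurable_bits measurable_const measurable_id)
          (measurableSet_singleton ⊤)).nullMeasurableSet).symm
    rw [Function.comp_apply, h1, hg]
    refine measure_congr ?_
    filter_upwards [he 1] with u hu
    exact propext hu.symm
  obtain ⟨c, hc⟩ := herg.ae_eq_const_of_ae_eq_comp₀ hgm.nullMeasurable hginv
  have h01 : c = 0 ∨ c = 1 := by
    obtain ⟨e, h1, h2⟩ := (hc.and hinv').exists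
    have := seqMeas_eq_zero_or_one h2
    change g e = c at h1
    rwa [← h1]
  rcases h01 with rfl | rfl
  · right
    refine (Measure.ae_prod_iff_ae_ae measurableSet_infiniteLeft.compl).2 ?_
    filter_upwards [hc] with e he
    have h0 : seqMeas {u | leftStepsTotal (bits e u) = ⊤} = 0 := he
    rw [ae_iff]
    simpa only [ne_eq, not_not] using! h0
  · left
    refine (Measure.ae_prod_iff_ae_ae measurableSet_infiniteLeft).2 ?_
    filter_upwards [hc] with e he
    exact (prob_compl_eq_zero_iff (measurable_leftStepsTotal (measurable_bits measurable_const
      measurable_id) (measurableSet_singleton ⊤))).2 he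

lemma meanDrift_eq_min {ρ : Measure (ℕ → ℕ → ℝ)} [IsProbabilityMeasure ρ]
    (hρ : ∀ᵐ e ∂ρ, ∀ z i, e z i ∈ Icc (1 / 2 : ℝ) 1) (herg : Ergodic shiftSeq ρ) :
    meanDrift ρ = min 1 (∫⁻ e, ∑' i, ENNReal.ofReal (2 * e 0 i - 1) ∂ρ) := by
  have hst := herg.toMeasurePreserving
  rcases leftStepsTotal_zero_one hρ herg with h | h
  · have h1 : meanDrift ρ = _ := meanDrift_eq_stackDrift
      ((hst.prod measurePreserving_shiftSeq_seqMeas).quasiMeasurePreserving.ae h)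
    rw [← h1, min_eq_right (meanDrift_le_one hρ hst)]
  · have h1 : meanDrift ρ = 1 := (meanDrift_le_one hρ hst).antisymm (one_le_meanDrift hρ hst h)
    rw [min_eq_left (h1 ▸ meanDrift_le_stackDrift ρ), h1]

/-- The number of visits of the path `X` to the site `z` at times `m < n`. -/
def visits (X : ℕ → ℤ) (n : ℕ) (z : ℤ) : ℕ := ((Finset.range n).filter fun m => X m = z).card

lemma visits_succ (X : ℕ → ℤ) (n : ℕ) (z : ℤ) :
    visits X (n + 1) z = visits X n z + if X n = z then 1 else 0 := by
  rw [visits, Finset.range_add_one, Finset.filter_insert]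
  split_ifs with h
  · rw [Finset.card_insert_of_notMem (by simp)]; rfl
  · rfl

lemma visits_mono (X : ℕ → ℤ) (z : ℤ) : Monotone fun n => visits X n z :=
  monotone_nat_of_le_succ fun n => by rw [visits_succ]; omega

lemma lt_visitsBefore_top_iff (X : ℕ → ℤ) (z : ℤ) (i : ℕ) :
    (i : ℕ∞) < visitsBefore X z ⊤ ↔ ∃ n, i < visits X n z := by
  have hset : {m : ℕ | (m : ℕ∞) < ⊤ ∧ X m = z} = {m | X m = z} := by
    ext m; simp
  rw [visitsBefore, hset]
  constructor
  · intro h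
    obtain ⟨t, hts, ht⟩ := Set.exists_subset_encard_eq (k := (i + 1 : ℕ)) (s := {m | X m = z})
      (by push_cast; exact Order.add_one_le_of_lt h)
    have htf : t.Finite := Set.finite_of_encard_eq_coe ht
    obtain ⟨n, hn⟩ := htf.toFinset.exists_nat_subset_range
    refine ⟨n, ?_⟩
    have hc : htf.toFinset.card = i + 1 := by
      rw [htf.encard_eq_coe_toFinset_card] at ht
      exact_mod_cast ht
    refine Nat.lt_of_succ_le (hc.ge.trans (Finset.card_le_card fun m hm => ?_))
    exact Finset.mem_filter.2 ⟨hn hm, hts (htf.mem_toFinset.1 hm)⟩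
  · rintro ⟨n, hn⟩
    refine lt_of_lt_of_le (Nat.cast_lt.2 hn) ?_
    rw [visits, ← Set.encard_coe_eq_coe_finsetCard]
    exact Set.encard_le_encard fun m hm => (Finset.mem_filter.1 hm).2

/-- The path `X` starts at `0` and follows the instructions `b`. -/
structure IsDriven (b : ℤ → ℕ → Bool) (X : ℕ → ℤ) : Prop where
  zero : X 0 = 0
  succ : ∀ n, X (n + 1) = if b (X n) (visits X n (X n)) then X n + 1 else X n - 1

namespace IsDriven

variable {b : ℤ → ℕ → Bool} {X : ℕ → ℤ}

lemma flow (h : IsDriven b X) {z : ℤ} (hz : 0 ≤ z) (n : ℕ) :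
    rightCount (b z) (visits X n z) + rightCount (b (z + 1)) (visits X n (z + 1)) =
      visits X n (z + 1) + if z < X n then 1 else 0 := by
  induction n with
  | zero => simp [visits, rightCount, h.zero, not_lt.2 hz]
  | succ n ih =>
    rw [visits_succ, visits_succ, h.succ]
    rcases eq_or_ne (X n) z with h1 | h1
    · have h2 : ¬ z = z + 1 := by omega
      simp only [h1, h2, if_true, if_false, lt_irrefl, add_zero] at ih ⊢
      rw [rightCount_succ]
      split_ifs <;> omega
    rcases eq_or_ne (X n) (z + 1) with h2 | h2
    · have h3 : ¬ z + 1 = z := by omega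
      have h4 : z < z + 1 := by omega
      simp only [h2, h3, h4, if_true, if_false, add_zero] at ih ⊢
      rw [rightCount_succ]
      split_ifs <;> omega
    · simp only [h1, h2, if_false, add_zero]
      rw [ih]
      split_ifs <;> omega

lemma exists_last_right (h : IsDriven b X) {z : ℤ} (hz : 0 ≤ z) (n : ℕ) (hn : z < X n) :
    ∃ k, visits X n z = k + 1 ∧ b z k = true := by
  induction n with
  | zero => rw [h.zero] at hn; omega
  | succ n ih =>
    rw [visits_succ]
    rw [h.succ] at hn
    rcases eq_or_ne (X n) z with h1 | h1
    · refine ⟨visits X n z, by simp [h1], ?_⟩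
      subst h1
      by_contra hb
      simp only [hb] at hn
      split_ifs at hn <;> omega
    · rw [if_neg h1, add_zero]
      refine ih ?_
      split_ifs at hn <;> omega

lemma le_time (h : IsDriven b X) (n : ℕ) : X n ≤ n := by
  induction n with
  | zero => simp [h.zero]
  | succ n ih =>
    rw [h.succ]
    push_cast
    split_ifs <;> omega

end IsDriven

lemma sum_lefts_add_rightCount (s : ℕ → Bool) (N : ℕ) :
    ∑ i ∈ Finset.range N, (if s i then 0 else 1 : ℕ) + rightCount s N = N := by
  rw [rightCount, ← Finset.sum_add_distrib]
  refine (Finset.sum_congr rfl fun i _ => ?_).trans (Finset.card_eq_sum_ones _).symm |>.trans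
    (Finset.card_range N)
  split_ifs <;> rfl

lemma leftsBefore_eq_of_iff {s : ℕ → Bool} {n : ℝ≥0∞} {N : ℕ}
    (h : ∀ i, (rightCount s i : ℝ≥0∞) < n + 1 ↔ i < N) :
    leftsBefore s n = ((N - rightCount s N : ℕ) : ℝ≥0∞) := by
  have h1 : leftsBefore s n = ∑ i ∈ Finset.range N, ((if s i then 0 else 1 : ℕ) : ℝ≥0∞) := by
    rw [leftsBefore, tsum_eq_sum (s := Finset.range N)]
    · refine Finset.sum_congr rfl fun i hi => ?_
      rw [usedInd, if_pos ((h i).2 (Finset.mem_range.1 hi))]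
      split_ifs <;> simp
    · intro i hi
      rw [usedInd, if_neg fun hcon => hi (Finset.mem_range.2 ((h i).1 hcon)), zero_mul]
  rw [h1, ← Nat.cast_sum]
  have := sum_lefts_add_rightCount s N
  congr 1
  omega

namespace IsDriven

variable {b : ℤ → ℕ → Bool} {X : ℕ → ℤ}

/-- At a time `t` when the walk has reached a new maximum, the number of used instructions at a
site is determined by the number of left steps from its right neighbour. -/
lemma rightCount_lt_iff (h : IsDriven b X) {z : ℤ} (hz : 0 ≤ z) {t : ℕ} (ht : z < X t) (i : ℕ) :
    (rightCount (b z) i : ℝ≥0∞) <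
      ((visits X t (z + 1) - rightCount (b (z + 1)) (visits X t (z + 1)) : ℕ) : ℝ≥0∞) + 1 ↔
      i < visits X t z := by
  rw [natCast_lt_add_one_iff]
  obtain ⟨k, hk, hb⟩ := h.exists_last_right hz t ht
  have hf := h.flow hz t
  have hl := sum_lefts_add_rightCount (b (z + 1)) (visits X t (z + 1))
  rw [if_pos ht, hk, rightCount_succ, hb, if_pos rfl] at hf
  rw [hk]
  constructor
  · intro hi
    by_contra hcon
    have := rightCount_mono (b z) (not_lt.1 hcon)
    rw [rightCount_succ, hb, if_pos rfl] at this
    omega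
  · intro hi
    have := rightCount_mono (b z) (Nat.lt_succ_iff.1 hi)
    omega

lemma leftSteps_eq (h : IsDriven b X) {K t : ℕ} (ht : (K : ℤ) ≤ X t) (hmin : ∀ m < t, X m < K)
    (j : ℕ) (hj : j ≤ K) :
    leftSteps j (fun n => b ((K - j : ℕ) + n : ℤ)) =
      ((visits X t (K - j : ℕ) - rightCount (b (K - j : ℕ)) (visits X t (K - j : ℕ)) : ℕ) :
        ℝ≥0∞) := by
  induction j with
  | zero =>
    have : visits X t K = 0 := by
      rw [visits, Finset.card_eq_zero, Finset.filter_eq_empty_iff]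
      exact fun m hm => (hmin m (Finset.mem_range.1 hm)).ne
    simp [leftSteps, this]
  | succ j ih =>
    have h1 : ((K - j : ℕ) : ℤ) = ((K - (j + 1) : ℕ) : ℤ) + 1 := by omega
    have h2 : shiftSeq (fun n : ℕ => b (((K - (j + 1) : ℕ) : ℤ) + n)) =
        fun n : ℕ => b (((K - j : ℕ) : ℤ) + n) := by
      funext n
      simp only [shiftSeq, h1]
      congr 1
      push_cast; ring
    rw [leftSteps, h2, ih (by omega), leftsBefore_eq_of_iff, Nat.cast_zero, add_zero]
    intro i
    rw [Nat.cast_zero, add_zero, h1]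
    exact h.rightCount_lt_iff (by omega) (by omega) i

lemma exists_lt_visits_iff (h : IsDriven b X) (hhit : ∀ K : ℕ, ∃ n, (K : ℤ) ≤ X n) (x : ℕ)
    (i : ℕ) : (∃ n, i < visits X n x) ↔
      (rightCount (b x) i : ℝ≥0∞) < leftStepsTotal (fun n => b ((x + 1 : ℕ) + n : ℤ)) + 1 := by
  classical
  have key : ∀ M : ℕ, ∃ t, M ≤ t ∧ (i < visits X t x ↔
      (rightCount (b x) i : ℝ≥0∞) < leftSteps M (fun n => b ((x + 1 : ℕ) + n : ℤ)) + 1) := by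
    intro M
    set K := x + 1 + M with hK
    have ht := Nat.find_spec (hhit K)
    set t := Nat.find (hhit K) with htdef
    have hmin : ∀ m < t, X m < K := fun m hm => not_le.1 (Nat.find_min (hhit K) hm)
    have hKM : K - M = x + 1 := by omega
    refine ⟨t, ?_, ?_⟩
    · have := h.le_time t
      omega
    · have h1 := h.leftSteps_eq ht hmin M (by omega)
      rw [hKM] at h1
      rw [h1, Nat.cast_succ x]
      exact (h.rightCount_lt_iff (z := x) (t := t) (by omega) (by omega) i).symm
  rw [leftStepsTotal, ENNReal.iSup_add, lt_iSup_iff]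
  constructor
  · rintro ⟨n, hn⟩
    obtain ⟨t, hnt, hiff⟩ := key n
    exact ⟨n, hiff.1 (hn.trans_le (visits_mono X x hnt))⟩
  · rintro ⟨M, hM⟩
    obtain ⟨t, -, hiff⟩ := key M
    exact ⟨t, hiff.2 hM⟩

lemma driftAt_eq (h : IsDriven b X) (hhit : ∀ K : ℕ, ∃ n, (K : ℤ) ≤ X n) (ω : CEnv) (x : ℕ) :
    driftAt ω X x ⊤ =
      driftBefore (ω x) (b x) (leftStepsTotal fun n => b ((x + 1 : ℕ) + n : ℤ)) := by
  classical
  rw [driftAt, driftBefore]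
  refine tsum_congr fun i => ?_
  rw [Set.indicator_apply, usedInd]
  simp only [mem_ofPred_eq, lt_visitsBefore_top_iff, h.exists_lt_visits_iff hhit x i]
  split_ifs <;> simp

end IsDriven

/-- Position and numbers of past visits of the walk driven by the instructions `b`. -/
def walkState (b : ℤ → ℕ → Bool) : ℕ → ℤ × (ℤ → ℕ)
  | 0 => (0, fun _ => 0)
  | n + 1 =>
    (if b (walkState b n).1 ((walkState b n).2 (walkState b n).1) then (walkState b n).1 + 1
      else (walkState b n).1 - 1,
      fun z => (walkState b n).2 z + if (walkState b n).1 = z then 1 else 0)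

/-- The walk driven by the instructions `b`. -/
def walk (b : ℤ → ℕ → Bool) (n : ℕ) : ℤ := (walkState b n).1

lemma walkState_snd (b : ℤ → ℕ → Bool) (n : ℕ) (z : ℤ) :
    (walkState b n).2 z = visits (walk b) n z := by
  induction n with
  | zero => simp [walkState, visits]
  | succ n ih => rw [visits_succ, ← ih]; rfl

lemma isDriven_walk (b : ℤ → ℕ → Bool) : IsDriven b (walk b) where
  zero := rfl
  succ n := by rw [← walkState_snd]; rfl

lemma measurable_apply_countable {α ι β : Type*} [MeasurableSpace α] [MeasurableSpace β]
    [MeasurableSpace ι] [Countable ι] [MeasurableSingletonClass ι] {f : α → ι → β} {g : α → ι}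
    (hf : Measurable f) (hg : Measurable g) : Measurable fun a => f a (g a) := by
  have h : Measurable fun q : α × ι => f q.1 q.2 :=
    measurable_from_prod_countable_left fun i => (measurable_pi_apply i).comp hf
  exact h.comp (f := fun a => (a, g a)) (measurable_id.prodMk hg)

lemma measurable_walk {α : Type*} [MeasurableSpace α] {f : α → ℤ → ℕ → Bool}
    (hf : Measurable f) : Measurable fun a => walk (f a) := by
  have h : ∀ n, Measurable fun a => walkState (f a) n := by
    intro n
    induction n with
    | zero => exact measurable_const
    | succ n ih =>
      have h1 : Measurable fun a => (walkState (f a) n).1 := ih.fst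
      have h2 := measurable_apply_countable ih.snd h1
      have h3 := measurable_apply_countable (measurable_apply_countable hf h1) h2
      refine Measurable.prodMk ?_ (measurable_pi_iff.2 fun z => ?_)
      · exact Measurable.ite (h3 (measurableSet_singleton true)) (h1.add_const 1) (h1.sub_const 1)
      · exact ((measurable_pi_apply z).comp ih.snd).add
          (Measurable.ite (h1 (measurableSet_singleton z)) measurable_const measurable_const)
  exact measurable_pi_iff.2 fun n => (h n).fst

lemma visits_congr {X x : ℕ → ℤ} {n : ℕ} (h : ∀ m ≤ n, X m = x m) :
    visits X n (X n) = prevVisits x n := by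
  rw [visits, prevVisits]
  congr 1
  refine Finset.filter_congr fun m hm => ?_
  rw [h m (Finset.mem_range.1 hm).le, h n le_rfl]

/-- The set of values of the uniform variable for which the step of the path `x` at time `n` is
taken. -/
def stepSet (ω : CEnv) (x : ℕ → ℤ) (n : ℕ) : Set ℝ :=
  if x (n + 1) = x n + 1 then {a | a < ω (x n) (prevVisits x n)}
  else if x (n + 1) = x n - 1 then {a | ¬ a < ω (x n) (prevVisits x n)}
  else ∅

lemma measurableSet_stepSet (ω : CEnv) (x : ℕ → ℤ) (n : ℕ) : MeasurableSet (stepSet ω x n) := by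
  rw [stepSet]
  split_ifs
  · exact measurableSet_Iio
  · exact measurableSet_Iio.compl
  · exact .empty

lemma IsCookieEnv.mem_Icc {ω : CEnv} (hω : IsCookieEnv ω) (z : ℤ) (i : ℕ) :
    ω z i ∈ Icc (0 : ℝ) 1 := ⟨by linarith [(hω z i).1], (hω z i).2⟩

lemma unif_stepSet {ω : CEnv} (hω : IsCookieEnv ω) (x : ℕ → ℤ) (n : ℕ) :
    unif (stepSet ω x n) = ENNReal.ofReal (stepProb ω x n) := by
  rw [stepSet, stepProb]
  split_ifs
  · exact unif_lt (hω.mem_Icc _ _)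
  · exact unif_not_lt (hω.mem_Icc _ _)
  · simp

lemma stepProb_nonneg {ω : CEnv} (hω : IsCookieEnv ω) (x : ℕ → ℤ) (n : ℕ) :
    0 ≤ stepProb ω x n := by
  have := hω.mem_Icc (x n) (prevVisits x n)
  rw [stepProb]
  split_ifs
  · exact this.1
  · linarith [this.2]
  · exact le_rfl

lemma walk_eq_iff (ω u : CEnv) (x : ℕ → ℤ) (n : ℕ) :
    (∀ m ≤ n, walk (fun z => arrows (ω z) (u z)) m = x m) ↔
      x 0 = 0 ∧ ∀ m < n, u (x m) (prevVisits x m) ∈ stepSet ω x m := by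
  set X := walk fun z => arrows (ω z) (u z)
  have hX : IsDriven _ X := isDriven_walk fun z => arrows (ω z) (u z)
  induction n with
  | zero =>
    simp [hX.zero, eq_comm]
  | succ n ih =>
    have h1 : (∀ m ≤ n + 1, X m = x m) ↔ (∀ m ≤ n, X m = x m) ∧ X (n + 1) = x (n + 1) := by
      constructor
      · exact fun h => ⟨fun m hm => h m (by omega), h _ le_rfl⟩
      · rintro ⟨h, h'⟩ m hm
        rcases hm.lt_or_eq with hm | rfl
        · exact h m (by omega)
        · exact h'
    have h2 : (∀ m < n + 1, u (x m) (prevVisits x m) ∈ stepSet ω x m) ↔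
        (∀ m < n, u (x m) (prevVisits x m) ∈ stepSet ω x m) ∧
          u (x n) (prevVisits x n) ∈ stepSet ω x n := by
      simp only [Nat.lt_succ_iff_lt_or_eq, or_imp, forall_and, forall_eq]
    rw [h1, h2, ← and_assoc, ih.symm]
    refine and_congr_right fun h => ?_
    rw [hX.succ, visits_congr h, h n le_rfl, stepSet, arrows]
    by_cases ha : u (x n) (prevVisits x n) < ω (x n) (prevVisits x n)
    · rcases eq_or_ne (x (n + 1)) (x n + 1) with h3 | h3
      · simp [h3, ha]
      · simp only [ha, decide_true, if_true, if_neg h3, Ne.symm h3, false_iff]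
        split_ifs <;> simp [ha]
    · rcases eq_or_ne (x (n + 1)) (x n - 1) with h3 | h3
      · have h5 : ¬ x n - 1 = x n + 1 := by omega
        simp [h3, h5, not_lt.1 ha]
      · simp only [ha, decide_false, if_neg h3, Ne.symm h3, false_iff, Bool.false_eq_true, if_false]
        split_ifs <;> simp [not_lt.1 ha]

/-- The law of the uniform variables at all sites. -/
def fieldMeas : Measure CEnv := Measure.infinitePi fun _ => stackMeas

instance : IsProbabilityMeasure fieldMeas := by unfold fieldMeas; infer_instance

lemma prevVisits_injOn {x : ℕ → ℤ} : Function.Injective fun m => (x m, prevVisits x m) := by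
  intro m n h
  have key : ∀ m n, m < n → x m = x n → prevVisits x m < prevVisits x n := by
    intro m n hmn hx
    refine Finset.card_lt_card ⟨fun k hk => ?_, fun hsub => ?_⟩
    · simp only [Finset.mem_filter, Finset.mem_range] at hk ⊢
      exact ⟨hk.1.trans hmn, hk.2.trans hx⟩
    · have := hsub (Finset.mem_filter.2 ⟨Finset.mem_range.2 hmn, hx⟩)
      simp at this
  simp only [Prod.mk.injEq] at h
  rcases lt_trichotomy m n with hmn | hmn | hmn
  · exact absurd h.2 (key m n hmn h.1).ne
  · exact hmn
  · exact absurd h.2.symm (key n m hmn h.1.symm).ne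

lemma fieldMeas_map_eval (z : ℤ) (i : ℕ) : fieldMeas.map (fun u => u z i) = unif := by
  have h1 : fieldMeas.map (fun u => u z) = stackMeas := Measure.infinitePi_map_eval _ z
  have h2 : stackMeas.map (fun u => u i) = unif := Measure.infinitePi_map_eval _ i
  rw [← h2, ← h1, Measure.map_map (by fun_prop) (by fun_prop)]
  rfl

lemma isERWLaw_map_walk {ω : CEnv} (hω : IsCookieEnv ω) :
    IsERWLaw ω 0 (fieldMeas.map fun u => walk fun z => arrows (ω z) (u z)) := by
  have hm : Measurable fun u : CEnv => walk fun z => arrows (ω z) (u z) :=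
    measurable_walk (measurable_pi_iff.2 fun z =>
      measurable_arrows measurable_const (measurable_pi_apply z))
  refine ⟨Measure.isProbabilityMeasure_map hm.aemeasurable, fun x n => ?_⟩
  have hset : MeasurableSet {Y : ℕ → ℤ | ∀ m ≤ n, Y m = x m} := by
    have : {Y : ℕ → ℤ | ∀ m ≤ n, Y m = x m} = ⋂ m ≤ n, (fun Y => Y m) ⁻¹' {x m} := by
      ext Y; simp
    rw [this]
    exact .iInter fun m => .iInter fun _ => measurable_pi_apply m (measurableSet_singleton _)
  rw [Measure.map_apply hm hset]
  have hpre : (fun u : CEnv => walk fun z => arrows (ω z) (u z)) ⁻¹'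
      {Y : ℕ → ℤ | ∀ m ≤ n, Y m = x m} =
      {u | x 0 = 0 ∧ ∀ m < n, u (x m) (prevVisits x m) ∈ stepSet ω x m} := by
    ext u
    exact walk_eq_iff ω u x n
  rw [hpre, cylProb]
  by_cases h0 : x 0 = 0
  · simp only [h0, true_and, if_true, one_mul]
    have hind : iIndepFun (fun (p : ℤ × ℕ) (u : CEnv) => u p.1 p.2) fieldMeas :=
      iIndepFun_uncurry_infinitePi' (μ := fun (_ : ℤ) (_ : ℕ) => unif) (X := fun _ _ a => a)
        (by fun_prop)
    have := (hind.precomp (prevVisits_injOn (x := x))).measure_inter_preimage_eq_mul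
      (Finset.range n) (sets := stepSet ω x) fun i _ => measurableSet_stepSet ω x i
    rw [ENNReal.ofReal_prod_of_nonneg fun i _ => stepProb_nonneg hω x i]
    convert this using 1
    · congr 1
      ext u
      simp
    · refine Finset.prod_congr rfl fun i _ => ?_
      rw [← unif_stepSet hω, ← fieldMeas_map_eval (x i) (prevVisits x i),
        Measure.map_apply (by fun_prop) (measurableSet_stepSet ω x i)]
  · simp [h0]

/-- A measure on paths is determined by its cylinder probabilities. -/
lemma IsERWLaw.unique {ω : CEnv} {P Q : Measure (ℕ → ℤ)} (hP : IsERWLaw ω 0 P)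
    (hQ : IsERWLaw ω 0 Q) : P = Q := by
  have := hP.1
  have := hQ.1
  have key : ∀ n : ℕ, P.map (Preorder.frestrictLe (π := fun _ => ℤ) n) =
      Q.map (Preorder.frestrictLe (π := fun _ => ℤ) n) := by
    intro n
    refine Measure.ext_of_singleton fun v => ?_
    rw [Measure.map_apply (by fun_prop) (measurableSet_singleton v),
      Measure.map_apply (by fun_prop) (measurableSet_singleton v)]
    have hpre : (Preorder.frestrictLe (π := fun _ => ℤ) n) ⁻¹' {v} =
        {Y : ℕ → ℤ | ∀ m ≤ n, Y m = if h : m ≤ n then v ⟨m, Finset.mem_Iic.2 h⟩ else 0} := by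
      ext Y
      simp only [mem_preimage, mem_singleton_iff, mem_ofPred_eq, funext_iff]
      constructor
      · intro h m hm
        rw [dif_pos hm]
        exact h ⟨m, Finset.mem_Iic.2 hm⟩
      · intro h m
        have := h m (Finset.mem_Iic.1 m.2)
        rwa [dif_pos (Finset.mem_Iic.1 m.2)] at this
    rw [hpre, hP.2, hQ.2]
  have hlim : IsProjectiveLimit P fun I : Finset ℕ => Q.map (I.restrict (π := fun _ => ℤ)) := by
    intro I
    have hI := I.subset_Iic_sup_id
    have h := congrArg (fun μ => μ.map (Finset.restrict₂ (π := fun _ => ℤ) hI)) (key (I.sup id))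
    simp only at h
    rwa [Measure.map_map (by fun_prop) (by fun_prop),
      Measure.map_map (by fun_prop) (by fun_prop)] at h
  exact hlim.unique fun _ => rfl

/-- The paths which follow `x` up to time `n`. -/
def cyl (x : ℕ → ℤ) (n : ℕ) : Set (ℕ → ℤ) := {Y | ∀ m ≤ n, Y m = x m}

lemma measurableSet_forall_le (s : ℕ → Set ℤ) (n : ℕ) :
    MeasurableSet {Y : ℕ → ℤ | ∀ m ≤ n, Y m ∈ s m} := by
  have : {Y : ℕ → ℤ | ∀ m ≤ n, Y m ∈ s m} = ⋂ m ≤ n, (fun Y => Y m) ⁻¹' s m := by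
    ext Y; simp
  rw [this]
  exact .iInter fun m => .iInter fun _ => measurable_pi_apply m (.of_discrete)

lemma measurableSet_cyl (x : ℕ → ℤ) (n : ℕ) : MeasurableSet (cyl x n) :=
  measurableSet_forall_le (fun m => {x m}) n

lemma stepProb_congr (ω : CEnv) {x y : ℕ → ℤ} {n : ℕ} (h : ∀ m ≤ n, x m = y m) :
    stepProb ω x n = if x (n + 1) = y n + 1 then ω (y n) (prevVisits y n)
      else if x (n + 1) = y n - 1 then 1 - ω (y n) (prevVisits y n) else 0 := by
  rw [stepProb, ← visits_congr h, ← h n le_rfl]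
  rfl

lemma cylProb_congr (ω : CEnv) {x y : ℕ → ℤ} {n : ℕ} (h : ∀ m ≤ n, x m = y m) :
    cylProb ω 0 x n = cylProb ω 0 y n := by
  rw [cylProb, cylProb, h 0 (by omega)]
  congr 1
  refine Finset.prod_congr rfl fun m hm => ?_
  have hm := Finset.mem_range.1 hm
  rw [stepProb_congr ω fun k hk => h k (by omega), stepProb, h (m + 1) (by omega)]

lemma cylProb_nonneg {ω : CEnv} (hω : IsCookieEnv ω) (x : ℕ → ℤ) (n : ℕ) :
    0 ≤ cylProb ω 0 x n :=
  mul_nonneg (by split_ifs <;> norm_num) (Finset.prod_nonneg fun m _ => stepProb_nonneg hω x m)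

lemma setLIntegral_cyl_succ {ω : CEnv} (hω : IsCookieEnv ω) {P : Measure (ℕ → ℤ)}
    (hP : IsERWLaw ω 0 P) (x : ℕ → ℤ) (n : ℕ) (φ : ℤ → ℝ≥0∞) :
    ∫⁻ Y in cyl x n, φ (Y (n + 1)) ∂P = P (cyl x n) *
      (ENNReal.ofReal (ω (x n) (prevVisits x n)) * φ (x n + 1) +
        ENNReal.ofReal (1 - ω (x n) (prevVisits x n)) * φ (x n - 1)) := by
  have h1 : ∀ z : ℤ, (P.restrict (cyl x n)) {Y | Y (n + 1) = z} =
      P (cyl x n) * ENNReal.ofReal (if z = x n + 1 then ω (x n) (prevVisits x n)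
      else if z = x n - 1 then 1 - ω (x n) (prevVisits x n) else 0) := by
    intro z
    have hagree : ∀ m ≤ n, Function.update x (n + 1) z m = x m := fun m hm =>
      Function.update_of_ne (by omega) _ _
    have hset : {Y : ℕ → ℤ | Y (n + 1) = z} ∩ cyl x n =
        {Y | ∀ m ≤ n + 1, Y m = Function.update x (n + 1) z m} := by
      ext Y
      simp only [cyl, mem_inter_iff, mem_ofPred_eq]
      constructor
      · rintro ⟨h, h'⟩ m hm
        rcases hm.lt_or_eq with hm | rfl
        · rw [hagree m (by omega), h' m (by omega)]
        · simpa using h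
      · intro h
        exact ⟨by simpa using h (n + 1) le_rfl, fun m hm => by
          rw [h m (by omega), hagree m hm]⟩
    rw [Measure.restrict_apply
      (measurableSet_eq_fun (measurable_pi_apply (n + 1)) measurable_const), hset,
      hP.2, cyl, hP.2, ← ENNReal.ofReal_mul (cylProb_nonneg hω x n)]
    congr 1
    have := stepProb_congr ω hagree
    rw [Function.update_self] at this
    rw [← this, ← cylProb_congr ω hagree, cylProb, Finset.prod_range_succ, ← mul_assoc]
    rfl
  have h2 : ∫⁻ Y in cyl x n, φ (Y (n + 1)) ∂P =
      ∑' z, φ z * (P.restrict (cyl x n)) {Y | Y (n + 1) = z} := by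
    rw [← lintegral_map (f := φ) (g := fun Y : ℕ → ℤ => Y (n + 1)) .of_discrete
      (measurable_pi_apply (n + 1)), lintegral_countable']
    refine tsum_congr fun z => ?_
    rw [Measure.map_apply (measurable_pi_apply (n + 1)) (measurableSet_singleton z)]
    rfl
  rw [h2, tsum_eq_sum (s := {x n + 1, x n - 1})]
  · have hne : x n + 1 ≠ x n - 1 := by omega
    rw [Finset.sum_pair hne, h1, h1, if_pos rfl, if_neg hne.symm, if_pos rfl]
    ring
  · intro z hz
    simp only [Finset.mem_insert, Finset.mem_singleton, not_or] at hz
    rw [h1, if_neg hz.1, if_neg hz.2]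
    simp

lemma lintegral_le_of_cyl {P : Measure (ℕ → ℤ)} {f g : (ℕ → ℤ) → ℝ≥0∞} (n : ℕ)
    (h : ∀ x, ∫⁻ Y in cyl x n, f Y ∂P ≤ ∫⁻ Y in cyl x n, g Y ∂P) : ∫⁻ Y, f Y ∂P ≤ ∫⁻ Y, g Y ∂P := by
  let ext : (Fin (n + 1) → ℤ) → ℕ → ℤ := fun v m => if h : m < n + 1 then v ⟨m, h⟩ else 0
  have hext : ∀ Y v, Y ∈ cyl (ext v) n ↔ (fun i : Fin (n + 1) => Y i) = v := by
    intro Y v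
    simp only [cyl, mem_ofPred_eq, ext, funext_iff]
    constructor
    · intro h i
      rw [h i (Nat.lt_succ_iff.1 i.2), dif_pos i.2]
    · intro h m hm
      rw [dif_pos (Nat.lt_succ_iff.2 hm), ← h]
  have hU : ⋃ v, cyl (ext v) n = univ := eq_univ_of_forall fun Y =>
    mem_iUnion.2 ⟨_, (hext Y _).2 rfl⟩
  have hdisj : Pairwise (Function.onFun Disjoint fun v => cyl (ext v) n) := by
    intro v w hvw
    refine Set.disjoint_left.2 fun Y hv hw => hvw ?_
    rw [← (hext Y v).1 hv, (hext Y w).1 hw]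
  have hsum : ∀ f : (ℕ → ℤ) → ℝ≥0∞, ∫⁻ Y, f Y ∂P = ∑' v, ∫⁻ Y in cyl (ext v) n, f Y ∂P := by
    intro f
    rw [← lintegral_iUnion (fun v => measurableSet_cyl _ n) hdisj, hU, Measure.restrict_univ]
  rw [hsum f, hsum g]
  exact ENNReal.tsum_le_tsum fun v => h _

/-- A superharmonic function for the distance to a level on the right. -/
def potential (z : ℝ) : ℝ := z + z / (z + 1)

/-- The expected decrease of `potential` during one step. -/
def potentialDrop (z : ℝ) : ℝ := 1 / (z * (z + 1) * (z + 2))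

lemma potential_nonneg {z : ℝ} (hz : 0 ≤ z) : 0 ≤ potential z := by unfold potential; positivity

lemma potential_step {z p : ℝ} (hz : 1 ≤ z) (hp : p ∈ Icc (1 / 2 : ℝ) 1) :
    p * potential (z - 1) + (1 - p) * potential (z + 1) + potentialDrop z ≤ potential z := by
  have h0 : 0 < z := by linarith
  have h1 : (potential (z - 1) + potential (z + 1)) / 2 + potentialDrop z = potential z := by
    unfold potential potentialDrop
    have : z - 1 + 1 ≠ 0 := by linarith
    have : z + 1 + 1 ≠ 0 := by linarith
    field_simp
    ring
  have h2 : potential (z - 1) ≤ potential (z + 1) := by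
    unfold potential
    have h3 : (z - 1) / (z - 1 + 1) ≤ (z + 1) / (z + 1 + 1) := by
      rw [div_le_div_iff₀ (by linarith) (by linarith)]
      nlinarith
    linarith
  nlinarith [mul_nonneg (sub_nonneg.2 hp.1) (sub_nonneg.2 h2)]

/-- The paths which stay below the level `K` up to time `n`. -/
def below (K n : ℕ) : Set (ℕ → ℤ) := {Y | ∀ m ≤ n, Y m < K}

lemma measurableSet_below (K n : ℕ) : MeasurableSet (below K n) :=
  measurableSet_forall_le (fun _ => Iio (K : ℤ)) n

/-- A function of the current distance to the level `K`, killed when the level is reached. -/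
def killed (f : ℝ → ℝ) (K n : ℕ) : (ℕ → ℤ) → ℝ≥0∞ :=
  (below K n).indicator fun Y => ENNReal.ofReal (f (K - Y n))

lemma measurable_killed (f : ℝ → ℝ) (K n : ℕ) : Measurable (killed f K n) := by
  refine Measurable.indicator ?_ (measurableSet_below K n)
  exact (Measurable.of_discrete (f := fun z : ℤ => ENNReal.ofReal (f (K - z)))).comp
    (measurable_pi_apply n)

lemma killed_potential_succ_le {ω : CEnv} (hω : IsCookieEnv ω) {P : Measure (ℕ → ℤ)}
    (hP : IsERWLaw ω 0 P) (K n : ℕ) :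
    ∫⁻ Y, killed potential K (n + 1) Y ∂P + ∫⁻ Y, killed potentialDrop K n Y ∂P ≤
      ∫⁻ Y, killed potential K n Y ∂P := by
  rw [← lintegral_add_left (measurable_killed _ _ _)]
  refine lintegral_le_of_cyl n fun x => ?_
  rw [lintegral_add_left (measurable_killed _ _ _)]
  by_cases hx : x ∈ below K n
  · have hmem : ∀ Y ∈ cyl x n, Y ∈ below K n := fun Y hY m hm => by rw [hY m hm]; exact hx m hm
    have hcur : ∀ f, ∫⁻ Y in cyl x n, killed f K n Y ∂P =
        P (cyl x n) * ENNReal.ofReal (f (K - x n)) := by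
      intro f
      rw [mul_comm, ← setLIntegral_const]
      refine setLIntegral_congr_fun (measurableSet_cyl x n) fun Y hY => ?_
      simp only [killed]
      rw [Set.indicator_of_mem (hmem Y hY), hY n le_rfl]
    have hnext : ∫⁻ Y in cyl x n, killed potential K (n + 1) Y ∂P ≤
        ∫⁻ Y in cyl x n, (fun z : ℤ => ENNReal.ofReal (potential (K - z))) (Y (n + 1)) ∂P :=
      lintegral_mono fun Y => Set.indicator_le_self _ _ Y
    refine (add_le_add_left hnext _).trans ?_
    rw [setLIntegral_cyl_succ hω hP x n fun z : ℤ => ENNReal.ofReal (potential (K - z)),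
      hcur, hcur, ← mul_add]
    gcongr
    set p := ω (x n) (prevVisits x n)
    have hp : p ∈ Icc (1 / 2 : ℝ) 1 := hω _ _
    have hz : (1 : ℝ) ≤ K - x n := by
      have : x n + 1 ≤ K := hx n le_rfl
      have : ((x n + 1 : ℤ) : ℝ) ≤ (K : ℤ) := by exact_mod_cast this
      push_cast at this
      linarith
    have e1 : (K : ℝ) - ((x n + 1 : ℤ) : ℝ) = K - x n - 1 := by push_cast; ring
    have e2 : (K : ℝ) - ((x n - 1 : ℤ) : ℝ) = K - x n + 1 := by push_cast; ring
    have n0 : 0 ≤ p := by linarith [hp.1]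
    have n1 : 0 ≤ 1 - p := by linarith [hp.2]
    have n2 := potential_nonneg (z := K - x n - 1) (by linarith)
    have n3 := potential_nonneg (z := K - x n + 1) (by linarith)
    have n4 : 0 ≤ potentialDrop (K - x n) := by
      unfold potentialDrop
      have : (0 : ℝ) < K - x n := by linarith
      positivity
    rw [e1, e2, ← ENNReal.ofReal_mul n0, ← ENNReal.ofReal_mul n1,
      ← ENNReal.ofReal_add (by positivity) (by positivity),
      ← ENNReal.ofReal_add (by positivity) n4]
    exact ENNReal.ofReal_le_ofReal (potential_step hz hp)
  · have hnot : ∀ Y ∈ cyl x n, Y ∉ below K n := fun Y hY hb => hx fun m hm => by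
      rw [← hY m hm]; exact (hb : ∀ m ≤ n, Y m < K) m hm
    have h1 : ∫⁻ Y in cyl x n, killed potential K (n + 1) Y ∂P = 0 := by
      rw [setLIntegral_congr_fun (measurableSet_cyl x n) (g := fun _ => 0)]
      · simp
      · exact fun Y hY => Set.indicator_of_notMem
          (fun hb => hnot Y hY fun m hm => (hb : ∀ m ≤ n + 1, Y m < K) m (by omega)) _
    have h2 : ∫⁻ Y in cyl x n, killed potentialDrop K n Y ∂P = 0 := by
      rw [setLIntegral_congr_fun (measurableSet_cyl x n) (g := fun _ => 0)]
      · simp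
      · exact fun Y hY => Set.indicator_of_notMem (hnot Y hY) _
    rw [h1, h2, add_zero]
    exact zero_le

lemma killed_potential_add_sum_le {ω : CEnv} (hω : IsCookieEnv ω) {P : Measure (ℕ → ℤ)}
    (hP : IsERWLaw ω 0 P) (K N : ℕ) :
    ∫⁻ Y, killed potential K N Y ∂P +
      ∑ n ∈ Finset.range N, ∫⁻ Y, killed potentialDrop K n Y ∂P ≤
      ENNReal.ofReal (potential K) := by
  have := hP.1
  induction N with
  | zero =>
    have h0 : ∀ᵐ Y ∂P, Y 0 = 0 := by
      have h := hP.2 (fun _ => 0) 0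
      simp only [Nat.le_zero, forall_eq, cylProb, if_true, Finset.range_zero,
        Finset.prod_empty, mul_one, ENNReal.ofReal_one] at h
      exact (prob_compl_eq_zero_iff (measurable_pi_apply 0 (measurableSet_singleton 0))).2 h
    rw [Finset.range_zero, Finset.sum_empty, add_zero]
    calc ∫⁻ Y, killed potential K 0 Y ∂P ≤ ∫⁻ _, ENNReal.ofReal (potential K) ∂P := by
          refine lintegral_mono_ae (h0.mono fun Y hY => ?_)
          refine (Set.indicator_le_self _ _ Y).trans ?_
          simp [hY]
      _ = _ := by simp
  | succ N ih =>
    rw [Finset.sum_range_succ, add_comm (Finset.sum _ _), ← add_assoc]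
    exact (add_le_add_left (killed_potential_succ_le hω hP K N) _).trans ih

lemma ae_hits {ω : CEnv} (hω : IsCookieEnv ω) {P : Measure (ℕ → ℤ)} (hP : IsERWLaw ω 0 P) :
    ∀ᵐ Y ∂P, ∀ K : ℕ, ∃ n, (K : ℤ) ≤ Y n := by
  refine ae_all_iff.2 fun K => ?_
  have hsum : ∫⁻ Y, ∑' n, killed potentialDrop K n Y ∂P ≠ ⊤ := by
    rw [lintegral_tsum fun n => (measurable_killed _ _ _).aemeasurable,
      ENNReal.tsum_eq_iSup_nat]
    refine ne_top_of_le_ne_top ENNReal.ofReal_ne_top (b := ENNReal.ofReal (potential K)) ?_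
    exact iSup_le fun N => le_add_self.trans (killed_potential_add_sum_le hω hP K N)
  have hlim : ∫⁻ Y, liminf (fun n => killed potential K n Y) atTop ∂P ≠ ⊤ := by
    refine ne_top_of_le_ne_top (ENNReal.ofReal_ne_top (r := potential K))
      ((lintegral_liminf_le fun n => measurable_killed potential K n).trans ?_)
    refine liminf_le_of_le (by isBoundedDefault) fun b hb => ?_
    obtain ⟨n, hn⟩ := hb.exists
    exact hn.trans (le_self_add.trans (killed_potential_add_sum_le hω hP K n))
  filter_upwards [ae_lt_top (.tsum fun n => measurable_killed _ _ _) hsum,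
    ae_lt_top (.liminf fun n => measurable_killed _ _ _) hlim] with Y h1 h2
  by_contra! hcon
  have hk : ∀ f n, killed f K n Y = ENNReal.ofReal (f (K - Y n)) := fun f n =>
    Set.indicator_of_mem (s := below K n) (fun m _ => hcon m) _
  simp only [hk] at h1 h2
  obtain ⟨M, hM1, hM2⟩ := ENNReal.lt_iff_exists_nnreal_btwn.1 h2
  have hfreq : ∃ᶠ n in atTop, ENNReal.ofReal (potential (K - Y n)) < M :=
    frequently_lt_of_liminf_lt (by isBoundedDefault) hM1
  have hpos : ∀ n, (1 : ℝ) ≤ K - Y n := fun n => by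
    have : ((Y n + 1 : ℤ) : ℝ) ≤ (K : ℤ) := by exact_mod_cast hcon n
    push_cast at this
    linarith
  have hM0 : (0 : ℝ) ≤ M := M.2
  set c : ℝ := 1 / ((M + 1) * (M + 1 + 1) * (M + 1 + 2)) with hc
  have hc0 : 0 < ENNReal.ofReal c := by rw [ENNReal.ofReal_pos]; positivity
  have htend := ENNReal.tendsto_atTop_zero_of_tsum_ne_top h1.ne
  obtain ⟨n, hn1, hn2⟩ := (hfreq.and_eventually (htend.eventually (gt_mem_nhds hc0))).exists
  refine absurd hn2 (not_lt.2 (ENNReal.ofReal_le_ofReal ?_))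
  have hz := hpos n
  have hlt : potential (K - Y n) < M := by
    rw [← ENNReal.ofReal_coe_nnreal] at hn1
    exact (ENNReal.ofReal_lt_ofReal_iff_of_nonneg (potential_nonneg (by linarith))).1 hn1
  have hle : (K : ℝ) - Y n ≤ M + 1 := by
    have : 0 ≤ ((K : ℝ) - Y n) / (K - Y n + 1) := by apply div_nonneg <;> linarith
    unfold potential at hlt
    linarith
  rw [hc, potentialDrop]
  have : (0 : ℝ) < K - Y n := by linarith
  gcongr

lemma measurable_visits (n : ℕ) (z : ℤ) : Measurable fun Y : ℕ → ℤ => visits Y n z := by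
  induction n with
  | zero => exact measurable_const
  | succ n ih =>
    simp only [visits_succ]
    exact ih.add (Measurable.ite (measurableSet_eq_fun (measurable_pi_apply n) measurable_const)
      measurable_const measurable_const)

lemma measurable_driftAt_top (z : ℤ) :
    Measurable fun p : CEnv × (ℕ → ℤ) => driftAt p.1 p.2 z ⊤ := by
  refine Measurable.tsum fun i => ?_
  simp only [lt_visitsBefore_top_iff]
  refine Measurable.ite ?_ (by fun_prop) measurable_const
  have : {p : CEnv × (ℕ → ℤ) | ∃ n, i < visits p.2 n z} =
      ⋃ n, {p : CEnv × (ℕ → ℤ) | i < visits p.2 n z} := by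
    ext p; simp
  change MeasurableSet {p : CEnv × (ℕ → ℤ) | ∃ n, i < visits p.2 n z}
  rw [this]
  exact .iUnion fun n =>
    measurableSet_lt measurable_const ((measurable_visits n z).comp measurable_snd)

lemma measurable_drift_leftStepsTotal :
    Measurable fun q : (ℕ → ℕ → ℝ) × (ℕ → ℕ → ℝ) =>
      driftBefore (q.1 0) (bits q.1 q.2 0) (leftStepsTotal (shiftSeq (bits q.1 q.2))) :=
  measurable_driftBefore (by fun_prop)
    ((measurable_pi_apply 0).comp (measurable_bits measurable_fst measurable_snd))
    (measurable_leftStepsTotal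
      (measurable_shiftSeq.comp (measurable_bits measurable_fst measurable_snd)))

/-- The quenched expected drift consumed at a site, in terms of the stacks to its right. -/
lemma lintegral_driftAt_top {ω : CEnv} (hω : IsCookieEnv ω) {P : Measure (ℕ → ℤ)}
    (hP : IsERWLaw ω 0 P) (x : ℕ) :
    ∫⁻ Y, driftAt ω Y x ⊤ ∂P =
      ∫⁻ u, driftBefore (shiftSeq^[x] (restrictNN ω) 0) (bits (shiftSeq^[x] (restrictNN ω)) u 0)
        (leftStepsTotal (shiftSeq (bits (shiftSeq^[x] (restrictNN ω)) u))) ∂seqMeas := by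
  set e := shiftSeq^[x] (restrictNN ω) with he
  have hF : Measurable fun u : ℕ → ℕ → ℝ => driftBefore (e 0) (bits e u 0)
      (leftStepsTotal (shiftSeq (bits e u))) :=
    measurable_driftBefore measurable_const
      ((measurable_pi_apply 0).comp (measurable_bits measurable_const measurable_id))
      (measurable_leftStepsTotal
        (measurable_shiftSeq.comp (measurable_bits measurable_const measurable_id)))
  have hQ := isERWLaw_map_walk hω
  have hhit := ae_hits hω hQ
  have hm : Measurable fun u : CEnv => walk fun z => arrows (ω z) (u z) :=
    measurable_walk (measurable_pi_iff.2 fun z =>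
      measurable_arrows measurable_const (measurable_pi_apply z))
  have hd : Measurable fun Y : ℕ → ℤ => driftAt ω Y x ⊤ :=
    (measurable_driftAt_top x).comp (f := fun Y => (ω, Y)) measurable_prodMk_left
  have hseq : fieldMeas.map (fun (u : CEnv) (i : ℕ) => u ((i + x : ℕ) : ℤ)) = seqMeas :=
    Measure.map_infinitePi_infinitePi_of_inj (P := fun _ : ℤ => stackMeas)
      (f := fun i : ℕ => ((i + x : ℕ) : ℤ)) fun i j h => by simpa using h
  rw [hP.unique hQ, lintegral_map hd hm, ← hseq,
    lintegral_map hF (by fun_prop)]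
  refine lintegral_congr_ae ?_
  filter_upwards [ae_of_ae_map hm.aemeasurable hhit] with u hu
  rw [(isDriven_walk fun z => arrows (ω z) (u z)).driftAt_eq hu, he, iterate_shiftSeq]
  have h0 : ∀ n : ℕ, ((x + 1 : ℕ) : ℤ) + n = ((n + 1 + x : ℕ) : ℤ) := fun n => by push_cast; ring
  simp only [h0]
  simp [bits, restrictNN]
  rfl

/-- Theorem 16, first part. If `(ω(x))_{x≥0}` is stationary and
ergodic under `Pr` then `E_0[D_∞^x] = min {1, 𝔼[δ^0]}` for every site `x ≥ 0`. -/
theorem erw_drift_at_site_eq_min (Pr : Measure CEnv) [IsProbabilityMeasure Pr]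
    (hcookie : ∀ᵐ ω ∂Pr, IsCookieEnv ω)
    (hstat : IsStatErgEnv Pr)
    (κ : Kernel CEnv (ℕ → ℤ)) [IsMarkovKernel κ]
    (hκ : ∀ ω, IsCookieEnv ω → IsERWLaw ω 0 (κ ω))
    (x : ℤ) (hx : 0 ≤ x) :
    ∫⁻ p, driftAt p.1 p.2 x ⊤ ∂(Pr.compProd κ) =
      min 1 (∫⁻ ω, cookieDrift ω 0 ∂Pr) := by
  lift x to ℕ using hx
  have hres : Measurable restrictNN :=
    measurable_pi_iff.2 fun n => measurable_pi_apply (n : ℤ)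
  have hprob : IsProbabilityMeasure (Pr.map restrictNN) :=
    Measure.isProbabilityMeasure_map hres.aemeasurable
  have hρ : ∀ᵐ e ∂(Pr.map restrictNN), ∀ z i, e z i ∈ Icc (1 / 2 : ℝ) 1 := by
    refine (ae_map_iff hres.aemeasurable ?_).2 (hcookie.mono fun ω hω z i => hω z i)
    simp only [Set.ofPred_forall]
    exact .iInter fun z => .iInter fun i =>
      (by fun_prop : Measurable fun e : ℕ → ℕ → ℝ => e z i) measurableSet_Icc
  have hmean := meanDrift_eq_min hρ hstat
  have hinner : Measurable fun e : ℕ → ℕ → ℝ => ∫⁻ u, driftBefore (e 0) (bits e u 0)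
      (leftStepsTotal (shiftSeq (bits e u))) ∂seqMeas :=
    measurable_drift_leftStepsTotal.lintegral_prod_right'
  rw [Measure.lintegral_compProd (measurable_driftAt_top _),
    lintegral_congr_ae (hcookie.mono fun ω hω => lintegral_driftAt_top hω (hκ ω hω) x)]
  rw [lintegral_map measurable_stackDrift hres] at hmean
  refine Eq.trans ?_ hmean
  have hst := hstat.toMeasurePreserving.iterate x
  rw [meanDrift, lintegral_prod _ measurable_drift_leftStepsTotal.aemeasurable,
    ← hst.lintegral_comp hinner]
  exact (lintegral_map (hinner.comp hst.measurable) hres).symm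

end
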